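/- Let d ≥ 1, let μ ∈ P_1(ℝ^d) be centered, and let u : ℝ^d → ℝ ∪ {+∞} be a convex, lower semicontinuous, proper, essentially continuous function such that ∫ e^{−u(x)} dx = 1, and such that the pushforward of the probability measure ρ̄ := e^{−u} dx under the a.e.-defined gradient ∇u equals μ. Then ρ̄ ∈ P_1(ℝ^d) and ρ̄ minimizes E(·) + T(·,μ) over P_1(ℝ^d): for every ρ ∈ P_1(ℝ^d), E(ρ̄) + T(ρ̄,μ) ≤ E(ρ) + T(ρ,μ). -/

import Mathlib

open MeasureTheory Real Filter Topology
open scoped ENNReal RealInnerProductSpace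

noncomputable section

/-- `d`-dimensional Euclidean space. -/
abbrev Ed (d : ℕ) := EuclideanSpace ℝ (Fin d)

open Classical in
/-- The entropy `E(ρ) = ∫ f ln f dx` (extended-real-valued, computed as positive part minus
negative part of the integral of `f ln f`, where `f` is the density), and `+∞` if `ρ` is not
absolutely continuous w.r.t. Lebesgue measure. -/
def entropy {d : ℕ} (ρ : Measure (Ed d)) : EReal :=
  if ρ ≪ (volume : Measure (Ed d)) then
    ((∫⁻ x, ENNReal.ofReal ((ρ.rnDeriv volume x).toReal *
        Real.log (ρ.rnDeriv volume x).toReal) : ℝ≥0∞) : EReal)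
      - ((∫⁻ x, ENNReal.ofReal (-((ρ.rnDeriv volume x).toReal *
        Real.log (ρ.rnDeriv volume x).toReal)) : ℝ≥0∞) : EReal)
  else ⊤

/-- The (extended-real-valued) integral `∫ ⟨x,y⟩ dγ(x,y)`: positive part minus negative part. -/
def pairInt {d : ℕ} (γ : Measure (Ed d × Ed d)) : EReal :=
  ((∫⁻ p, ENNReal.ofReal (⟪p.1, p.2⟫ : ℝ) ∂γ : ℝ≥0∞) : EReal)
    - ((∫⁻ p, ENNReal.ofReal (-(⟪p.1, p.2⟫ : ℝ)) ∂γ : ℝ≥0∞) : EReal)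

/-- Transport plans: probability measures on the product with marginals `ρ` and `μ`. -/
def Couplings {d : ℕ} (ρ μ : Measure (Ed d)) : Set (Measure (Ed d × Ed d)) :=
  {γ | IsProbabilityMeasure γ ∧ γ.fst = ρ ∧ γ.snd = μ}

/-- The maximal correlation functional `T(ρ,μ) = sup { ∫⟨x,y⟩ dγ : γ ∈ Π(ρ,μ) }`. -/
def maxCorr {d : ℕ} (ρ μ : Measure (Ed d)) : EReal :=
  ⨆ γ ∈ Couplings ρ μ, pairInt γ

/-- `ρ` has finite first moment. -/
def FirstMoment {d : ℕ} (ρ : Measure (Ed d)) : Prop := Integrable (fun x => ‖x‖) ρ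

/-- `ρ` is centered: its barycenter is `0`. -/
def Centered {d : ℕ} (ρ : Measure (Ed d)) : Prop := (∫ x, x ∂ρ) = 0

/-- Weak convergence of measures: convergence of integrals of bounded continuous functions. -/
def WeakConv {d : ℕ} (ρs : ℕ → Measure (Ed d)) (ρ : Measure (Ed d)) : Prop :=
  ∀ f : BoundedContinuousFunction (Ed d) ℝ,
    Tendsto (fun n => ∫ x, f x ∂(ρs n)) atTop (𝓝 (∫ x, f x ∂ρ))

/-- Convexity for extended-real-valued functions on `Ed d`. -/
def EConvexOn {d : ℕ} (u : Ed d → EReal) : Prop :=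
  ∀ x y : Ed d, ∀ a b : ℝ, 0 ≤ a → 0 ≤ b → a + b = 1 →
    u (a • x + b • y) ≤ (a : EReal) * u x + (b : EReal) * u y

/-- `e^{-t}` for `t ∈ ℝ ∪ {+∞}`, with `e^{-∞} = 0`. -/
def expNegE (t : EReal) : ℝ := if t = ⊤ then 0 else Real.exp (-t.toReal)

/-- The Legendre transform `u*(y) = sup_x (⟨x,y⟩ - u(x))`. -/
def legendre {d : ℕ} (u : Ed d → EReal) (y : Ed d) : EReal :=
  ⨆ x : Ed d, (((⟪x, y⟫ : ℝ) : EReal) - u x)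

/-- The essential continuity of a convex l.s.c. function `u : ℝ^d → ℝ ∪ {+∞}`:
`u` tends to `+∞` at `H^{d-1}`-a.e. point of the boundary of its domain. -/
def EssentiallyContinuous {d : ℕ} (u : Ed d → EReal) : Prop :=
  μH[(d : ℝ) - 1] {x : Ed d | x ∈ frontier {y | u y < ⊤} ∧ u x < ⊤} = 0

/-- The quantile at level `c` of a monotone function `G`, clamped to `[-R, R]`. -/
def clampedQuantile (R : ℝ) (G : ℝ → ℝ) (c : ℝ) : ℝ :=
  sInf {r | -R ≤ r ∧ (c ≤ G r ∨ R ≤ r)}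

section Quantile

variable {R : ℝ} {G : ℝ → ℝ} {c : ℝ}

theorem clampedQuantile_bddBelow : BddBelow {r | -R ≤ r ∧ (c ≤ G r ∨ R ≤ r)} :=
  ⟨-R, fun _ hr => hr.1⟩

theorem clampedQuantile_nonempty (hR : 0 ≤ R) :
    {r | -R ≤ r ∧ (c ≤ G r ∨ R ≤ r)}.Nonempty := ⟨R, by simp; linarith⟩

theorem neg_le_clampedQuantile (hR : 0 ≤ R) : -R ≤ clampedQuantile R G c :=
  le_csInf (clampedQuantile_nonempty hR) fun _ hr => hr.1

theorem clampedQuantile_le (hR : 0 ≤ R) : clampedQuantile R G c ≤ R :=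
  csInf_le clampedQuantile_bddBelow ⟨by linarith, Or.inr le_rfl⟩

theorem abs_clampedQuantile_le (hR : 0 ≤ R) : |clampedQuantile R G c| ≤ R :=
  abs_le.2 ⟨neg_le_clampedQuantile hR, clampedQuantile_le hR⟩

theorem monotone_clampedQuantile (hR : 0 ≤ R) : Monotone (clampedQuantile R G) := by
  intro c c' h
  exact csInf_le_csInf clampedQuantile_bddBelow (clampedQuantile_nonempty hR)
    fun r hr => ⟨hr.1, hr.2.imp_left h.trans⟩

theorem clampedQuantile_lt_iff (hR : 0 ≤ R) (hG : Monotone G) {a : ℝ} :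
    clampedQuantile R G c < a ↔ ∃ r : ℚ, (r : ℝ) < a ∧ -R ≤ r ∧ (c ≤ G r ∨ R ≤ r) := by
  constructor
  · intro h
    obtain ⟨r, hr, hra⟩ := exists_lt_of_csInf_lt (clampedQuantile_nonempty hR) h
    obtain ⟨s, hs, hsa⟩ := exists_rat_btwn hra
    exact ⟨s, hsa, hr.1.trans hs.le,
      hr.2.imp (fun h => h.trans (hG hs.le)) (fun h => h.trans hs.le)⟩
  · rintro ⟨r, hra, hr⟩
    exact (csInf_le clampedQuantile_bddBelow hr).trans_lt hra

theorem measurable_clampedQuantile {α : Type*} [MeasurableSpace α] (hR : 0 ≤ R)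
    {G : α → ℝ → ℝ} (hG : ∀ a, Monotone (G a)) (hGm : ∀ r, Measurable fun a => G a r)
    {c : α → ℝ} (hc : Measurable c) : Measurable fun a => clampedQuantile R (G a) (c a) := by
  refine measurable_of_Iio fun b => ?_
  have : (fun a => clampedQuantile R (G a) (c a)) ⁻¹' Set.Iio b =
      ⋃ r : ℚ, {a | (r : ℝ) < b ∧ -R ≤ r ∧ (c a ≤ G a r ∨ R ≤ r)} := by
    ext a
    simp [clampedQuantile_lt_iff hR (hG a)]
  rw [this]
  refine MeasurableSet.iUnion fun r => ?_
  exact (MeasurableSet.const _).inter ((MeasurableSet.const _).inter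
    ((measurableSet_le hc (hGm r)).union (MeasurableSet.const _)))

theorem le_apply_clampedQuantile (hR : 0 ≤ R) (hGc : Continuous G) (hGR : c ≤ G R) :
    c ≤ G (clampedQuantile R G c) := by
  have hcl : IsClosed {r | -R ≤ r ∧ (c ≤ G r ∨ R ≤ r)} :=
    (isClosed_le continuous_const continuous_id).inter
      ((isClosed_le continuous_const hGc).union (isClosed_le continuous_const continuous_id))
  have := hcl.csInf_mem (clampedQuantile_nonempty hR) clampedQuantile_bddBelow
  rcases this.2 with h | h
  · exact h
  · have h2 : clampedQuantile R G c = R := le_antisymm (clampedQuantile_le hR) h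
    rwa [h2]

theorem apply_clampedQuantile (hR : 0 ≤ R) (hGc : Continuous G) (hGR : c ≤ G R)
    (hGR' : G (-R) ≤ c) : G (clampedQuantile R G c) = c := by
  refine le_antisymm ?_ (le_apply_clampedQuantile hR hGc hGR)
  rcases (neg_le_clampedQuantile (G := G) (c := c) hR).eq_or_lt with h | h
  · rwa [← h]
  · refine le_of_tendsto (hGc.continuousWithinAt (s := Set.Iio (clampedQuantile R G c))) ?_
    filter_upwards [Ioo_mem_nhdsLT h] with r hr
    by_contra! hcr
    exact absurd (csInf_le clampedQuantile_bddBelow ⟨hr.1.le, Or.inl hcr.le⟩) (not_le.2 hr.2)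

theorem clampedQuantile_le_iff (hR : 0 ≤ R) (hG : Monotone G) (hGc : Continuous G)
    (hGR : c ≤ G R) {a : ℝ} (ha : -R ≤ a) : clampedQuantile R G c ≤ a ↔ c ≤ G a :=
  ⟨fun h => (le_apply_clampedQuantile hR hGc hGR).trans (hG h),
    fun h => csInf_le clampedQuantile_bddBelow ⟨ha, Or.inl h⟩⟩

end Quantile

section MonotoneRearrangement

open ProbabilityTheory

theorem continuous_cdf (ν : Measure ℝ) [IsProbabilityMeasure ν] [NullSingletonClass ν] :
    Continuous (cdf ν) := by
  rw [continuous_iff_continuousAt]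
  intro x
  rw [(monotone_cdf ν).continuousAt_iff_leftLim_eq_rightLim]
  have h1 := (cdf ν).measure_singleton x
  rw [measure_cdf, measure_singleton] at h1
  have h2 := ENNReal.ofReal_eq_zero.1 h1.symm
  have h3 : Function.rightLim (cdf ν) x = cdf ν x := (cdf ν).rightLim_eq x
  have h4 := (monotone_cdf ν).leftLim_le (le_refl x)
  rw [h3]; linarith

theorem measureReal_cdf_le (ν : Measure ℝ) [IsProbabilityMeasure ν] [NullSingletonClass ν] {c : ℝ}
    (hc0 : 0 ≤ c) (hc1 : c ≤ 1) : ν.real {t | cdf ν t ≤ c} = c := by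
  rcases hc1.eq_or_lt with rfl | hc1
  · simp [cdf_le_one]
  have hcont := continuous_cdf ν
  rcases Set.eq_empty_or_nonempty {t | cdf ν t ≤ c} with he | hne
  · have : c ≤ 0 := ge_of_tendsto (tendsto_cdf_atBot ν) (Eventually.of_forall fun t => by
      by_contra! h
      exact (he ▸ (show t ∈ {t | cdf ν t ≤ c} from h.le) : t ∈ (∅ : Set ℝ)).elim)
    rw [he]; simp; linarith
  have hbdd : BddAbove {t | cdf ν t ≤ c} := by
    obtain ⟨b, hb⟩ := ((tendsto_cdf_atTop ν).eventually (lt_mem_nhds hc1)).exists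
    exact ⟨b, fun t ht => by
      by_contra! h
      exact absurd ((monotone_cdf ν) h.le) (not_le.2 (lt_of_le_of_lt ht hb))⟩
  have hcl : IsClosed {t | cdf ν t ≤ c} := isClosed_le hcont continuous_const
  have hmem := hcl.csSup_mem hne hbdd
  set t₀ := sSup {t | cdf ν t ≤ c}
  have heq : {t | cdf ν t ≤ c} = Set.Iic t₀ := by
    ext t
    exact ⟨fun h => le_csSup hbdd h, fun h => ((monotone_cdf ν) h).trans hmem⟩
  have h1 : c ≤ cdf ν t₀ := by
    refine ge_of_tendsto (hcont.continuousWithinAt (s := Set.Ioi t₀)) ?_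
    filter_upwards [self_mem_nhdsWithin] with t ht
    by_contra! h
    exact absurd (le_csSup hbdd (show t ∈ {t | cdf ν t ≤ c} from h.le)) (not_le.2 ht)
  rw [heq, ← cdf_eq_real]
  exact le_antisymm hmem h1

/-- The monotone rearrangement of `ν` onto a measure `κ` supported in `[-R, R]`. -/
theorem map_monotone_rearrangement {R : ℝ} (hR : 0 ≤ R) (ν κ : Measure ℝ)
    [IsProbabilityMeasure ν] [NullSingletonClass ν] [IsProbabilityMeasure κ] [NullSingletonClass κ]
    (hκ : κ (Set.Icc (-R) R)ᶜ = 0) :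
    ν.map (fun t => clampedQuantile R (cdf κ) (cdf ν t)) = κ ∧
    ∀ t, cdf κ (clampedQuantile R (cdf κ) (cdf ν t)) = cdf ν t := by
  have hcont := continuous_cdf κ
  have hG0 : ∀ a < -R, cdf κ a = 0 := by
    intro a ha
    rw [cdf_eq_real, measureReal_def, measure_mono_null _ hκ, ENNReal.toReal_zero]
    intro t ht hmem
    exact absurd (le_trans hmem.1 ht) (not_le.2 ha)
  have hG0' : cdf κ (-R) = 0 := by
    rw [cdf_eq_real, measureReal_def]
    have : Set.Iic (-R) ⊆ (Set.Icc (-R) R)ᶜ ∪ {-R} := by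
      intro t ht
      rcases (show t ≤ -R from ht).eq_or_lt with h | h
      · right; exact h
      · left; intro h2; exact absurd h2.1 (not_le.2 h)
    rw [measure_mono_null this (measure_union_null hκ (measure_singleton _)),
      ENNReal.toReal_zero]
  have hG1 : cdf κ R = 1 := by
    rw [cdf_eq_real, measureReal_def, (prob_compl_eq_zero_iff measurableSet_Iic).1,
      ENNReal.toReal_one]
    refine measure_mono_null ?_ hκ
    intro t ht h
    exact ht h.2
  have hm : Measurable fun t => clampedQuantile R (cdf κ) (cdf ν t) :=
    ((monotone_clampedQuantile hR).comp (monotone_cdf ν)).measurable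
  have hle : ∀ t, cdf ν t ≤ cdf κ R := fun t => hG1 ▸ cdf_le_one ν t
  refine ⟨?_, fun t => apply_clampedQuantile hR hcont (hle t) (hG0' ▸ cdf_nonneg ν t)⟩
  have : IsProbabilityMeasure (ν.map fun t => clampedQuantile R (cdf κ) (cdf ν t)) :=
    Measure.isProbabilityMeasure_map hm.aemeasurable
  refine Measure.ext_of_Iic _ _ fun a => ?_
  rw [Measure.map_apply hm measurableSet_Iic]
  rcases lt_or_ge a (-R) with ha | ha
  · have : (fun t => clampedQuantile R (cdf κ) (cdf ν t)) ⁻¹' Set.Iic a = ∅ := by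
      ext t
      simp only [Set.mem_preimage, Set.mem_Iic, Set.mem_empty_iff_false, iff_false, not_le]
      exact ha.trans_le (neg_le_clampedQuantile hR)
    rw [this, measure_empty]
    have := hG0 a ha
    rw [cdf_eq_real, measureReal_eq_zero_iff] at this
    exact this.symm
  · have : (fun t => clampedQuantile R (cdf κ) (cdf ν t)) ⁻¹' Set.Iic a =
        {t | cdf ν t ≤ cdf κ a} := by
      ext t
      exact clampedQuantile_le_iff hR (monotone_cdf κ) hcont (hle t) ha
    rw [this, ← ofReal_cdf, ← ofReal_measureReal,
      measureReal_cdf_le ν (cdf_nonneg κ a) (cdf_le_one κ a)]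

theorem ae_hasDerivAt_cdf_withDensity {p : ℝ → ℝ≥0∞} (hp : Measurable p)
    [IsProbabilityMeasure (volume.withDensity p)] :
    ∀ᵐ t, HasDerivAt (cdf (volume.withDensity p)) (p t).toReal t := by
  have h := (cdf (volume.withDensity p)).ae_hasDerivAt
  rw [measure_cdf] at h
  filter_upwards [h, Measure.rnDeriv_withDensity volume hp] with t h1 h2
  rwa [h2] at h1

/-- The change of variables formula for the monotone rearrangement. -/
theorem ae_hasDerivAt_monotone_rearrangement {R : ℝ} (hR : 0 ≤ R) {p q : ℝ → ℝ≥0∞}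
    (hp : Measurable p) (hq : Measurable q)
    [IsProbabilityMeasure (volume.withDensity p)] [IsProbabilityMeasure (volume.withDensity q)]
    (hqR : ∀ t, t ∉ Set.Icc (-R) R → q t = 0) :
    (volume.withDensity p).map (fun t => clampedQuantile R (cdf (volume.withDensity q))
      (cdf (volume.withDensity p) t)) = volume.withDensity q ∧
    ∀ᵐ t ∂(volume.withDensity p), ∃ D : ℝ,
      HasDerivAt (fun t => clampedQuantile R (cdf (volume.withDensity q))
        (cdf (volume.withDensity p) t)) D t ∧
      p t = q (clampedQuantile R (cdf (volume.withDensity q))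
        (cdf (volume.withDensity p) t)) * ENNReal.ofReal D := by
  set T := fun t => clampedQuantile R (cdf (volume.withDensity q))
        (cdf (volume.withDensity p) t) with hT
  have hκ : (volume.withDensity q) (Set.Icc (-R) R)ᶜ = 0 := by
    rw [withDensity_apply _ measurableSet_Icc.compl]
    exact setLIntegral_eq_zero measurableSet_Icc.compl hqR
  obtain ⟨hmap, hcomp⟩ := map_monotone_rearrangement hR (volume.withDensity p)
    (volume.withDensity q) hκ
  have hTmono : Monotone T := (monotone_clampedQuantile hR).comp (monotone_cdf _)
  refine ⟨hmap, ?_⟩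
  have hac : volume.withDensity p ≪ volume := withDensity_absolutelyContinuous _ _
  have hpfin : ∀ᵐ t, p t < ∞ := ae_lt_top hp (by
    have := measure_univ (μ := volume.withDensity p)
    rw [withDensity_apply _ .univ, setLIntegral_univ] at this
    simp [this])
  have hqfin : ∀ᵐ t, q t < ∞ := ae_lt_top hq (by
    have := measure_univ (μ := volume.withDensity q)
    rw [withDensity_apply _ .univ, setLIntegral_univ] at this
    simp [this])
  have hq' : ∀ᵐ t ∂(volume.withDensity q),
      HasDerivAt (cdf (volume.withDensity q)) (q t).toReal t ∧ q t < ∞ :=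
    (withDensity_absolutelyContinuous _ _).ae_le
      ((ae_hasDerivAt_cdf_withDensity hq).and hqfin)
  rw [← hmap] at hq'
  have hq'' := ae_of_ae_map hTmono.measurable.aemeasurable hq'
  rw [hmap] at hq''
  filter_upwards [hac.ae_le (ae_hasDerivAt_cdf_withDensity hp), hac.ae_le hpfin, hq'',
    hac.ae_le hTmono.ae_differentiableAt] with t h1 h2 h3 h4
  refine ⟨deriv T t, h4.hasDerivAt, ?_⟩
  have h5 := h3.1.comp t h4.hasDerivAt
  have h6 : (cdf (volume.withDensity q)) ∘ T = cdf (volume.withDensity p) := funext hcomp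
  rw [h6] at h5
  have h7 := h1.unique h5
  have h8 : 0 ≤ deriv T t := hTmono.deriv_nonneg
  rw [← ENNReal.ofReal_toReal h2.ne, h7, ENNReal.ofReal_mul ENNReal.toReal_nonneg,
    ENNReal.ofReal_toReal h3.2.ne]

end MonotoneRearrangement

section Cons

theorem measurable_fin_cons {n : ℕ} :
    Measurable fun p : ℝ × (Fin n → ℝ) => (Fin.cons p.1 p.2 : Fin (n + 1) → ℝ) := by
  refine measurable_pi_lambda _ fun i => ?_
  refine Fin.cases ?_ (fun j => ?_) i
  · simpa using measurable_fst
  · simpa [Function.comp_def] using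
      (measurable_pi_apply (X := fun _ : Fin n => ℝ) j).comp (measurable_snd (α := ℝ))

theorem measurable_fin_tail {n : ℕ} :
    Measurable fun x : Fin (n + 1) → ℝ => (Fin.tail x : Fin n → ℝ) :=
  measurable_pi_lambda _ fun i => measurable_pi_apply i.succ

theorem lintegral_fin_cons {n : ℕ} {φ : (Fin (n + 1) → ℝ) → ℝ≥0∞} (hφ : Measurable φ) :
    ∫⁻ x, φ x = ∫⁻ y : Fin n → ℝ, ∫⁻ t : ℝ, φ (Fin.cons t y) := by
  have h := (volume_preserving_piFinSuccAbove (fun _ : Fin (n + 1) => ℝ) 0).symm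
  rw [← h.lintegral_comp_emb (MeasurableEquiv.measurableEmbedding _)]
  rw [Measure.volume_eq_prod, lintegral_prod_symm']
  · simp [MeasurableEquiv.piFinSuccAbove, Fin.insertNthEquiv, Fin.insertNth_zero']
  · exact hφ.comp (MeasurableEquiv.measurable _)

theorem ae_fin_cons {n : ℕ} {P : (Fin (n + 1) → ℝ) → Prop} (hP : MeasurableSet {x | P x})
    (h : ∀ᵐ y : Fin n → ℝ, ∀ᵐ t : ℝ, P (Fin.cons t y)) : ∀ᵐ x, P x := by
  rw [ae_iff]
  have h1 : MeasurableSet {x | ¬ P x} := hP.compl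
  rw [← lintegral_indicator_one h1, lintegral_fin_cons (measurable_one.indicator h1)]
  rw [lintegral_eq_zero_iff' ?_]
  · filter_upwards [h] with y hy
    simp only [Pi.zero_apply]
    refine (lintegral_congr_ae ?_).trans lintegral_zero
    filter_upwards [hy] with t ht
    simp [ht]
  · exact (Measurable.lintegral_prod_right'
      (f := fun p : (Fin n → ℝ) × ℝ => Set.indicator {x | ¬ P x} 1 (Fin.cons p.2 p.1))
      ((measurable_one.indicator h1).comp (measurable_fin_cons.comp measurable_swap))).aemeasurable

end Cons

/-- The lower right derivative, along a sequence, of the `k`-th component of a map in the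
`k`-th direction. -/
def diagSlope {n : ℕ} (S : (Fin n → ℝ) → Fin n → ℝ) (k : Fin n) (x : Fin n → ℝ) : ℝ≥0∞ :=
  liminf (fun m : ℕ => ENNReal.ofReal (((m : ℝ) + 1) *
    (S (Function.update x k (x k + 1 / ((m : ℝ) + 1))) k - S x k))) atTop

theorem measurable_diagSlope {n : ℕ} {S : (Fin n → ℝ) → Fin n → ℝ} (hS : Measurable S)
    (k : Fin n) : Measurable (diagSlope S k) := by
  refine Measurable.liminf fun m => ENNReal.measurable_ofReal.comp (Measurable.const_mul ?_ _)
  have h1 : Measurable fun x : Fin n → ℝ =>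
      Function.update x k (x k + 1 / ((m : ℝ) + 1)) := by
    refine measurable_pi_lambda _ fun i => ?_
    by_cases h : i = k
    · subst h; simpa using (measurable_pi_apply i).add_const _
    · simpa [Function.update_of_ne h] using measurable_pi_apply i
  exact ((measurable_pi_apply k).comp (hS.comp h1)).sub ((measurable_pi_apply k).comp hS)

theorem liminf_ofReal_slope {T : ℝ → ℝ} {D t : ℝ} (h : HasDerivAt T D t) :
    liminf (fun m : ℕ => ENNReal.ofReal (((m : ℝ) + 1) *
      (T (t + 1 / ((m : ℝ) + 1)) - T t))) atTop = ENNReal.ofReal D := by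
  refine Tendsto.liminf_eq (ENNReal.tendsto_ofReal ?_)
  have h1 := h.tendsto_slope_zero
  have h2 : Tendsto (fun m : ℕ => 1 / ((m : ℝ) + 1)) atTop (𝓝[≠] 0) :=
    tendsto_nhdsWithin_iff.2 ⟨tendsto_one_div_add_atTop_nhds_zero_nat,
      Eventually.of_forall fun m => by
        have : (0 : ℝ) < 1 / ((m : ℝ) + 1) := by positivity
        exact this.ne'⟩
  refine (h1.comp h2).congr fun m => ?_
  simp

section Conditional

variable {n : ℕ}

/-- The density of the marginal of `f` in all coordinates but the first. -/
def tailDensity (f : (Fin (n + 1) → ℝ) → ℝ≥0∞) (y : Fin n → ℝ) : ℝ≥0∞ := ∫⁻ t, f (Fin.cons t y)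

/-- The conditional density of the first coordinate given the others. -/
def condDensity (f : (Fin (n + 1) → ℝ) → ℝ≥0∞) (y : Fin n → ℝ) (t : ℝ) : ℝ≥0∞ :=
  f (Fin.cons t y) / tailDensity f y

/-- The conditional distribution function of the first coordinate given the others. -/
def condCdf (f : (Fin (n + 1) → ℝ) → ℝ≥0∞) (y : Fin n → ℝ) (t : ℝ) : ℝ :=
  (volume.withDensity (condDensity f y)).real (Set.Iic t)

variable {f : (Fin (n + 1) → ℝ) → ℝ≥0∞}

theorem measurable_tailDensity (hf : Measurable f) : Measurable (tailDensity f) :=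
  Measurable.lintegral_prod_right' (f := fun p : (Fin n → ℝ) × ℝ => f (Fin.cons p.2 p.1))
    (hf.comp (measurable_fin_cons.comp measurable_swap))

theorem measurable_condDensity_uncurry (hf : Measurable f) :
    Measurable fun p : (Fin n → ℝ) × ℝ => condDensity f p.1 p.2 :=
  (hf.comp (measurable_fin_cons.comp measurable_swap)).div
    ((measurable_tailDensity hf).comp measurable_fst)

theorem measurable_condDensity (hf : Measurable f) (y : Fin n → ℝ) :
    Measurable (condDensity f y) :=
  (measurable_condDensity_uncurry hf).comp measurable_prodMk_left

theorem lintegral_tailDensity (hf : Measurable f) : ∫⁻ y, tailDensity f y = ∫⁻ x, f x :=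
  (lintegral_fin_cons hf).symm

theorem lintegral_condDensity (hf : Measurable f) (y : Fin n → ℝ) :
    ∫⁻ t, condDensity f y t = tailDensity f y / tailDensity f y := by
  simp only [condDensity, div_eq_mul_inv]
  rw [lintegral_mul_const]
  · rfl
  · exact hf.comp (measurable_fin_cons.comp measurable_prodMk_right)

theorem isFiniteMeasure_condDensity (hf : Measurable f) (y : Fin n → ℝ) :
    IsFiniteMeasure (volume.withDensity (condDensity f y)) := by
  refine isFiniteMeasure_withDensity ?_
  rw [lintegral_condDensity hf]
  exact (ENNReal.div_self_le_one.trans_lt ENNReal.one_lt_top).ne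

theorem isProbabilityMeasure_condDensity (hf : Measurable f) {y : Fin n → ℝ}
    (h0 : tailDensity f y ≠ 0) (h1 : tailDensity f y ≠ ∞) :
    IsProbabilityMeasure (volume.withDensity (condDensity f y)) := by
  refine ⟨?_⟩
  rw [withDensity_apply _ .univ, setLIntegral_univ, lintegral_condDensity hf, ENNReal.div_self h0 h1]

theorem monotone_condCdf (hf : Measurable f) (y : Fin n → ℝ) : Monotone (condCdf f y) := by
  have := isFiniteMeasure_condDensity hf y
  intro s t hst
  exact measureReal_mono (Set.Iic_subset_Iic.2 hst)

theorem measurable_condCdf {α : Type*} [MeasurableSpace α] (hf : Measurable f)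
    {y : α → Fin n → ℝ} {t : α → ℝ} (hy : Measurable y) (ht : Measurable t) :
    Measurable fun a => condCdf f (y a) (t a) := by
  simp only [condCdf, measureReal_def]
  refine ENNReal.measurable_toReal.comp ?_
  have : (fun a => volume.withDensity (condDensity f (y a)) (Set.Iic (t a))) =
      fun a => ∫⁻ s, {p : α × ℝ | p.2 ≤ t p.1}.indicator
        (fun p => condDensity f (y p.1) p.2) (a, s) := by
    ext a
    rw [withDensity_apply _ measurableSet_Iic, ← lintegral_indicator measurableSet_Iic]
    rfl
  rw [this]
  refine Measurable.lintegral_prod_right' (Measurable.indicator ?_ ?_)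
  · exact (measurable_condDensity_uncurry hf).comp
      ((hy.comp measurable_fst).prodMk measurable_snd)
  · exact measurableSet_le measurable_snd (ht.comp measurable_fst)

theorem tailDensity_mul_condDensity {y : Fin n → ℝ} (h0 : tailDensity f y ≠ 0)
    (h1 : tailDensity f y ≠ ∞) (t : ℝ) :
    tailDensity f y * condDensity f y t = f (Fin.cons t y) :=
  ENNReal.mul_div_cancel h0 h1

theorem ae_eq_zero_of_tailDensity_eq_zero (hf : Measurable f) {y : Fin n → ℝ}
    (h0 : tailDensity f y = 0) : ∀ᵐ t, f (Fin.cons t y) = 0 :=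
  (lintegral_eq_zero_iff (hf.comp (measurable_fin_cons.comp measurable_prodMk_right))).1 h0

theorem lintegral_mul_fin_cons (hf : Measurable f) (hfin : ∫⁻ x, f x ≠ ∞)
    {φ : (Fin (n + 1) → ℝ) → ℝ≥0∞} (hφ : Measurable φ) :
    ∫⁻ x, f x * φ x =
      ∫⁻ y, tailDensity f y * ∫⁻ t, condDensity f y t * φ (Fin.cons t y) := by
  rw [show ∫⁻ x, f x * φ x = ∫⁻ x, (f * φ) x from rfl, lintegral_fin_cons (hf.mul hφ)]
  refine lintegral_congr_ae ?_
  rw [← lintegral_tailDensity hf] at hfin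
  filter_upwards [ae_lt_top (measurable_tailDensity hf) hfin] with y hy
  by_cases h0 : tailDensity f y = 0
  · simp only [h0, zero_mul, Pi.mul_apply]
    refine (lintegral_congr_ae ?_).trans lintegral_zero
    filter_upwards [ae_eq_zero_of_tailDensity_eq_zero hf h0] with t ht
    simp [ht]
  · rw [← lintegral_const_mul]
    · simp only [← mul_assoc, tailDensity_mul_condDensity h0 hy.ne, Pi.mul_apply]
    · exact (measurable_condDensity hf y).mul
        (hφ.comp (measurable_fin_cons.comp measurable_prodMk_right))

end Conditional

section Knothe

open ProbabilityTheory

variable {n : ℕ}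

theorem condCdf_eq_cdf {f : (Fin (n + 1) → ℝ) → ℝ≥0∞} {y : Fin n → ℝ}
    [IsProbabilityMeasure (volume.withDensity (condDensity f y))] :
    condCdf f y = cdf (volume.withDensity (condDensity f y)) :=
  funext fun t => (cdf_eq_real _ t).symm

/-- One step of the Knothe–Rosenblatt construction: extend a map of the last coordinates by the
monotone rearrangement of the conditional laws of the first coordinate. -/
def knotheExtend (R : ℝ) (f g : (Fin (n + 1) → ℝ) → ℝ≥0∞) (S : (Fin n → ℝ) → Fin n → ℝ)
    (x : Fin (n + 1) → ℝ) : Fin (n + 1) → ℝ :=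
  Fin.cons (clampedQuantile R (condCdf g (S (Fin.tail x))) (condCdf f (Fin.tail x) (x 0)))
    (S (Fin.tail x))

theorem measurable_knotheExtend {R : ℝ} (hR : 0 ≤ R) {f g : (Fin (n + 1) → ℝ) → ℝ≥0∞}
    (hf : Measurable f) (hg : Measurable g) {S : (Fin n → ℝ) → Fin n → ℝ} (hS : Measurable S) :
    Measurable (knotheExtend R f g S) := by
  have hS' : Measurable fun x : Fin (n + 1) → ℝ => S (Fin.tail x) := hS.comp measurable_fin_tail
  refine measurable_fin_cons.comp (Measurable.prodMk ?_ hS')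
  exact measurable_clampedQuantile hR (fun _ => monotone_condCdf hg _)
    (fun r => measurable_condCdf hg hS' measurable_const)
    (measurable_condCdf hf measurable_fin_tail (measurable_pi_apply 0))

theorem knotheExtend_update_zero (R : ℝ) (f g : (Fin (n + 1) → ℝ) → ℝ≥0∞)
    (S : (Fin n → ℝ) → Fin n → ℝ) (x : Fin (n + 1) → ℝ) (t : ℝ) :
    knotheExtend R f g S (Function.update x 0 t) 0 =
      clampedQuantile R (condCdf g (S (Fin.tail x))) (condCdf f (Fin.tail x) t) := by
  simp [knotheExtend]

theorem knotheExtend_update_succ (R : ℝ) (f g : (Fin (n + 1) → ℝ) → ℝ≥0∞)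
    (S : (Fin n → ℝ) → Fin n → ℝ) (x : Fin (n + 1) → ℝ) (j : Fin n) (t : ℝ) :
    knotheExtend R f g S (Function.update x j.succ t) j.succ =
      S (Function.update (Fin.tail x) j t) j := by
  simp [knotheExtend]

theorem diagSlope_knotheExtend_succ (R : ℝ) (f g : (Fin (n + 1) → ℝ) → ℝ≥0∞)
    (S : (Fin n → ℝ) → Fin n → ℝ) (x : Fin (n + 1) → ℝ) (j : Fin n) :
    diagSlope (knotheExtend R f g S) j.succ x = diagSlope S j (Fin.tail x) := by
  simp only [diagSlope, knotheExtend_update_succ]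
  rfl

theorem diagSlope_knotheExtend_zero (R : ℝ) (f g : (Fin (n + 1) → ℝ) → ℝ≥0∞)
    (S : (Fin n → ℝ) → Fin n → ℝ) (y : Fin n → ℝ) {t D : ℝ}
    (h : HasDerivAt (fun t => clampedQuantile R (condCdf g (S y)) (condCdf f y t)) D t) :
    diagSlope (knotheExtend R f g S) 0 (Fin.cons t y) = ENNReal.ofReal D := by
  rw [← liminf_ofReal_slope h]
  simp only [diagSlope, knotheExtend_update_zero]
  simp [knotheExtend]

/-- Existence of the Knothe–Rosenblatt map between two densities, the target being supported in
a cube, together with its Jacobian equation. -/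
theorem exists_knothe_map {R : ℝ} (hR : 0 ≤ R) (n : ℕ) {f g : (Fin n → ℝ) → ℝ≥0∞}
    (hf : Measurable f) (hg : Measurable g) (hf1 : ∫⁻ x, f x = 1) (hg1 : ∫⁻ x, g x = 1)
    (hgR : ∀ y k, y k ∉ Set.Icc (-R) R → g y = 0) :
    ∃ S : (Fin n → ℝ) → Fin n → ℝ, Measurable S ∧ (∀ x k, |S x k| ≤ R) ∧
      (∀ x k, Monotone fun t => S (Function.update x k t) k) ∧
      (volume.withDensity f).map S = volume.withDensity g ∧
      ∀ᵐ x ∂(volume.withDensity f), (∀ k, diagSlope S k x < ∞) ∧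
        f x = g (S x) * ∏ k, diagSlope S k x := by
  induction n with
  | zero =>
    have hconst : ∀ {f : (Fin 0 → ℝ) → ℝ≥0∞}, ∫⁻ x, f x = 1 → f = fun _ => 1 := by
      intro f hf
      rw [Measure.volume_pi_eq_dirac 0, lintegral_dirac] at hf
      ext x
      rw [Subsingleton.elim x 0, hf]
    refine ⟨id, measurable_id, fun _ k => k.elim0, fun _ k => k.elim0, ?_, ?_⟩
    · rw [Measure.map_id, hconst hf1, hconst hg1]
    · refine Eventually.of_forall fun x => ⟨fun k => k.elim0, ?_⟩
      simp [hconst hf1, hconst hg1]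
  | succ n ih =>
    obtain ⟨S, hSm, hSR, hSmono, hSmap, hSder⟩ := ih (measurable_tailDensity hf)
      (measurable_tailDensity hg) (by rw [lintegral_tailDensity hf, hf1])
      (by rw [lintegral_tailDensity hg, hg1]) (fun y k hk => by
        simp only [tailDensity]
        refine (lintegral_congr fun t => hgR _ k.succ ?_).trans lintegral_zero
        simpa using hk)
    have hTm := measurable_knotheExtend hR hf hg hSm
    have hffin : ∀ᵐ y, tailDensity f y < ∞ := ae_lt_top (measurable_tailDensity hf) (by
      rw [lintegral_tailDensity hf, hf1]; exact ENNReal.one_ne_top)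
    have hgfin : ∀ᵐ y, tailDensity g y < ∞ := ae_lt_top (measurable_tailDensity hg) (by
      rw [lintegral_tailDensity hg, hg1]; exact ENNReal.one_ne_top)
    have hggood : ∀ᵐ y ∂(volume.withDensity (tailDensity f)),
        tailDensity g (S y) ≠ 0 ∧ tailDensity g (S y) ≠ ∞ := by
      refine ae_of_ae_map hSm.aemeasurable
        (p := fun y => tailDensity g y ≠ 0 ∧ tailDensity g y ≠ ∞) ?_
      rw [hSmap, ae_withDensity_iff (measurable_tailDensity hg)]
      filter_upwards [hgfin] with y hy h0 using ⟨h0, hy.ne⟩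
    rw [ae_withDensity_iff (measurable_tailDensity hf)] at hggood hSder
    have hline : ∀ᵐ y, tailDensity f y ≠ 0 →
        (volume.withDensity (condDensity f y)).map
          (fun t => clampedQuantile R (condCdf g (S y)) (condCdf f y t)) =
            volume.withDensity (condDensity g (S y)) ∧
        ∀ᵐ t, condDensity f y t ≠ 0 → ∃ D : ℝ,
          HasDerivAt (fun t => clampedQuantile R (condCdf g (S y)) (condCdf f y t)) D t ∧
          condDensity f y t = condDensity g (S y)
            (clampedQuantile R (condCdf g (S y)) (condCdf f y t)) * ENNReal.ofReal D := by
      filter_upwards [hffin, hggood] with y h1 h2 h0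
      obtain ⟨h2, h3⟩ := h2 h0
      have := isProbabilityMeasure_condDensity hf h0 h1.ne
      have := isProbabilityMeasure_condDensity hg h2 h3
      rw [condCdf_eq_cdf, condCdf_eq_cdf, ← ae_withDensity_iff (measurable_condDensity hf y)]
      refine ae_hasDerivAt_monotone_rearrangement hR (measurable_condDensity hf y)
        (measurable_condDensity hg (S y)) fun t ht => ?_
      simp only [condDensity]
      rw [hgR _ 0 (by simpa using ht), ENNReal.zero_div]
    refine ⟨knotheExtend R f g S, hTm, ?_, ?_, ?_, ?_⟩
    · intro x k
      refine Fin.cases ?_ (fun j => ?_) k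
      · exact abs_clampedQuantile_le hR
      · exact hSR _ j
    · intro x k
      refine Fin.cases ?_ (fun j => ?_) k
      · simp only [knotheExtend_update_zero]
        exact (monotone_clampedQuantile hR).comp (monotone_condCdf hf _)
      · simp only [knotheExtend_update_succ]
        exact hSmono _ j
    · refine Measure.ext_of_lintegral _ fun φ hφ => ?_
      have e0 := lintegral_withDensity_eq_lintegral_mul volume hf (hφ.comp hTm)
      simp only [Function.comp_apply] at e0
      rw [lintegral_map hφ hTm, e0, lintegral_withDensity_eq_lintegral_mul _ hg hφ]
      have e1 := lintegral_mul_fin_cons hf (by rw [hf1]; exact ENNReal.one_ne_top) (hφ.comp hTm)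
      have e2 := lintegral_mul_fin_cons hg (by rw [hg1]; exact ENNReal.one_ne_top) hφ
      refine e1.trans (Eq.trans ?_ e2.symm)
      set Φ : (Fin n → ℝ) → ℝ≥0∞ := fun y => ∫⁻ t, condDensity g y t * φ (Fin.cons t y)
        with hΦ
      have hΦm : Measurable Φ := Measurable.lintegral_prod_right'
        (f := fun p : (Fin n → ℝ) × ℝ => condDensity g p.1 p.2 * φ (Fin.cons p.2 p.1))
        ((measurable_condDensity_uncurry hg).mul
          (hφ.comp (measurable_fin_cons.comp measurable_swap)))
      calc _ = ∫⁻ y, tailDensity f y * Φ (S y) := by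
            refine lintegral_congr_ae ?_
            filter_upwards [hline] with y hy
            by_cases h0 : tailDensity f y = 0
            · simp [h0]
            congr 1
            have hφy : Measurable fun t : ℝ => φ (Fin.cons t (S y)) :=
              hφ.comp (measurable_fin_cons.comp measurable_prodMk_right)
            have hQ : Measurable fun t =>
                clampedQuantile R (condCdf g (S y)) (condCdf f y t) :=
              ((monotone_clampedQuantile hR).comp (monotone_condCdf hf y)).measurable
            have e3 := lintegral_withDensity_eq_lintegral_mul volume
              (measurable_condDensity hg (S y)) hφy
            rw [← (hy h0).1, lintegral_map hφy hQ] at e3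
            exact (lintegral_withDensity_eq_lintegral_mul _ (measurable_condDensity hf y)
              (hφy.comp hQ)).symm.trans e3
        _ = ∫⁻ y, Φ y ∂((volume.withDensity (tailDensity f)).map S) := by
            rw [lintegral_map hΦm hSm]
            exact (lintegral_withDensity_eq_lintegral_mul _
              (measurable_tailDensity hf) (hΦm.comp hSm)).symm
        _ = _ := by
            rw [hSmap, lintegral_withDensity_eq_lintegral_mul _
              (measurable_tailDensity hg) hΦm]
            rfl
    · rw [ae_withDensity_iff hf]
      have hmeas : ∀ k, Measurable (diagSlope (knotheExtend R f g S) k) :=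
        measurable_diagSlope hTm
      refine ae_fin_cons ?_ ?_
      · have hA : MeasurableSet {x | f x ≠ 0} := hf (measurableSet_singleton 0).compl
        have hB : MeasurableSet {x | (∀ k, diagSlope (knotheExtend R f g S) k x < ∞) ∧
            f x = g (knotheExtend R f g S x) * ∏ k, diagSlope (knotheExtend R f g S) k x} := by
          refine MeasurableSet.inter (s₁ := {x | ∀ k, diagSlope (knotheExtend R f g S) k x < ∞})
            ?_ ?_
          · have : {x | ∀ k, diagSlope (knotheExtend R f g S) k x < ∞} =
                ⋂ k, {x | diagSlope (knotheExtend R f g S) k x < ∞} := by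
              ext x; simp
            rw [this]
            exact MeasurableSet.iInter fun k => measurableSet_lt (hmeas k) measurable_const
          · exact measurableSet_eq_fun hf
              ((hg.comp hTm).mul (Finset.measurable_fun_prod _ fun k _ => hmeas k))
        exact hA.imp hB
      · filter_upwards [hline, hSder, hffin, hggood] with y hy hSy hfy hgy
        by_cases h0 : tailDensity f y = 0
        · filter_upwards [ae_eq_zero_of_tailDensity_eq_zero hf h0] with t ht h using absurd ht h
        filter_upwards [(hy h0).2] with t ht hft
        have hc := tailDensity_mul_condDensity h0 hfy.ne t
        obtain ⟨D, hD, hpD⟩ := ht fun h => hft (by rw [← hc, h, mul_zero])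
        obtain ⟨hS1, hS2⟩ := hSy h0
        have hz := diagSlope_knotheExtend_zero R f g S y hD
        refine ⟨fun k => ?_, ?_⟩
        · refine Fin.cases ?_ (fun j => ?_) k
          · rw [hz]; exact ENNReal.ofReal_lt_top
          · rw [diagSlope_knotheExtend_succ]; exact hS1 j
        · rw [Fin.prod_univ_succ, hz]
          simp only [diagSlope_knotheExtend_succ, Fin.tail_cons]
          have hg' := tailDensity_mul_condDensity (hgy h0).1 (hgy h0).2
            (clampedQuantile R (condCdf g (S y)) (condCdf f y t))
          have hval : knotheExtend R f g S (Fin.cons t y) =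
              Fin.cons (clampedQuantile R (condCdf g (S y)) (condCdf f y t)) (S y) := by
            simp [knotheExtend]
          rw [hval, ← hg', ← hc, hpD, hS2]
          ring

end Knothe

section ConvexBasics

variable {d : ℕ} {u : Ed d → EReal}

/-- The effective domain of an extended-real-valued function. -/
def effDom (u : Ed d → EReal) : Set (Ed d) := {x | u x < ⊤}

/-- The density `e^{-u}`. -/
def expNegDensity (u : Ed d → EReal) (x : Ed d) : ℝ := expNegE (u x)

/-- The gradient of the real-valued version of an extended-real-valued function. -/
def realGradient (u : Ed d → EReal) (x : Ed d) : Ed d := gradient (fun y => (u y).toReal) x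

theorem coe_toReal_of_mem_effDom (hubot : ∀ x, u x ≠ ⊥) {x : Ed d} (hx : x ∈ effDom u) :
    ((u x).toReal : EReal) = u x :=
  EReal.coe_toReal (ne_of_lt hx) (hubot x)

theorem expNegDensity_nonneg (x : Ed d) : 0 ≤ expNegDensity u x := by
  unfold expNegDensity expNegE
  split_ifs <;> positivity

theorem expNegDensity_of_mem {x : Ed d} (hx : x ∈ effDom u) :
    expNegDensity u x = Real.exp (-(u x).toReal) :=
  if_neg (ne_of_lt hx)

theorem expNegDensity_of_notMem {x : Ed d} (hx : x ∉ effDom u) : expNegDensity u x = 0 :=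
  if_pos (not_lt_top_iff.1 hx)

theorem expNegDensity_pos_iff {x : Ed d} : 0 < expNegDensity u x ↔ x ∈ effDom u := by
  constructor
  · intro h
    by_contra hx
    rw [expNegDensity_of_notMem hx] at h
    exact lt_irrefl _ h
  · intro h
    rw [expNegDensity_of_mem h]
    positivity

theorem measurable_expNegDensity (hulsc : LowerSemicontinuous u) :
    Measurable (expNegDensity u) := by
  unfold expNegDensity expNegE
  have hu := hulsc.measurable
  exact Measurable.ite (hu (measurableSet_singleton ⊤)) measurable_const
    hu.ereal_toReal.neg.exp

theorem measurable_realGradient : Measurable (realGradient u) :=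
  (InnerProductSpace.toDual ℝ (Ed d)).symm.continuous.measurable.comp (measurable_fderiv ℝ _)

theorem toReal_combo_le (hubot : ∀ x, u x ≠ ⊥) (huconv : EConvexOn u) {x y : Ed d}
    (hx : x ∈ effDom u) (hy : y ∈ effDom u) {a b : ℝ} (ha : 0 ≤ a) (hb : 0 ≤ b)
    (hab : a + b = 1) : u (a • x + b • y) ≤ ((a * (u x).toReal + b * (u y).toReal : ℝ) : EReal) := by
  have h := huconv x y a b ha hb hab
  rw [← coe_toReal_of_mem_effDom hubot hx, ← coe_toReal_of_mem_effDom hubot hy] at h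
  exact_mod_cast h

theorem convex_effDom (hubot : ∀ x, u x ≠ ⊥) (huconv : EConvexOn u) : Convex ℝ (effDom u) :=
  fun _ hx _ hy _ _ ha hb hab =>
    (toReal_combo_le hubot huconv hx hy ha hb hab).trans_lt (EReal.coe_lt_top _)

theorem convexOn_toReal (hubot : ∀ x, u x ≠ ⊥) (huconv : EConvexOn u) :
    ConvexOn ℝ (effDom u) fun x => (u x).toReal := by
  refine ⟨convex_effDom hubot huconv, fun x hx y hy a b ha hb hab => ?_⟩
  have h := toReal_combo_le hubot huconv hx hy ha hb hab
  rw [← coe_toReal_of_mem_effDom hubot (convex_effDom hubot huconv hx hy ha hb hab)] at h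
  exact_mod_cast h

theorem ConvexOn.ae_differentiableAt_interior {E : Type*} [NormedAddCommGroup E]
    [NormedSpace ℝ E] [FiniteDimensional ℝ E] [MeasurableSpace E] [BorelSpace E]
    {ν : Measure E} [ν.IsAddHaarMeasure] {s : Set E} {f : E → ℝ} (hf : ConvexOn ℝ s f) :
    ∀ᵐ x ∂ν, x ∈ interior s → DifferentiableAt ℝ f x := by
  have h : ν {x | x ∈ interior s ∧ ¬ DifferentiableAt ℝ f x} = 0 := by
    refine measure_null_of_locally_null _ fun x hx => ?_
    obtain ⟨K, t, ht, hL⟩ := hf.locallyLipschitzOn_interior hx.1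
    have ht' : t ∈ 𝓝 x := by
      rwa [IsOpen.nhdsWithin_eq isOpen_interior hx.1] at ht
    have := hL.ae_differentiableWithinAt_of_mem (μ := ν)
    refine ⟨{y | y ∈ interior t ∧ ¬ DifferentiableAt ℝ f y}, ?_, ?_⟩
    · filter_upwards [mem_nhdsWithin_of_mem_nhds (interior_mem_nhds.2 ht'),
        self_mem_nhdsWithin] with y hy hy2 using ⟨hy, hy2.2⟩
    · refine measure_mono_null ?_ (ae_iff.1 this)
      rintro y ⟨hy1, hy2⟩ hy3
      exact hy2 ((hy3 (interior_subset hy1)).differentiableAt (mem_interior_iff_mem_nhds.1 hy1))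
  rw [ae_iff]
  simpa [Classical.not_imp] using h

theorem fderiv_toReal_apply (x e : Ed d) :
    fderiv ℝ (fun y => (u y).toReal) x e = ⟪realGradient u x, e⟫ := by
  simp [realGradient, gradient]

theorem tangent_le (hubot : ∀ x, u x ≠ ⊥) (huconv : EConvexOn u) {x y : Ed d}
    (hx : x ∈ effDom u) (hy : y ∈ effDom u)
    (hd : DifferentiableAt ℝ (fun y => (u y).toReal) x) :
    (u x).toReal + ⟪y - x, realGradient u x⟫ ≤ (u y).toReal := by
  have hc := (convexOn_toReal hubot huconv).comp_affineMap (AffineMap.lineMap x y)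
  have hder : HasDerivAt ((fun y => (u y).toReal) ∘ (AffineMap.lineMap x y : ℝ →ᵃ[ℝ] Ed d))
      (fderiv ℝ (fun y => (u y).toReal) x (y - x)) 0 := by
    have hd' : HasFDerivAt (fun y => (u y).toReal) (fderiv ℝ (fun y => (u y).toReal) x)
      ((AffineMap.lineMap x y : ℝ →ᵃ[ℝ] Ed d) 0) := by simpa using hd.hasFDerivAt
    exact hd'.comp_hasDerivAt 0 AffineMap.hasDerivAt_lineMap
  have := hc.le_slope_of_hasDerivAt (x := 0) (y := 1) (by simpa using hx) (by simpa using hy)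
    one_pos hder
  rw [fderiv_toReal_apply, slope_def_field] at this
  simp only [Function.comp_apply, AffineMap.lineMap_apply_zero, AffineMap.lineMap_apply_one] at this
  rw [real_inner_comm] at this
  linarith

theorem interior_effDom_nonempty (hubot : ∀ x, u x ≠ ⊥) (huconv : EConvexOn u)
    (hnorm : ∫ x, expNegDensity u x = 1) : (interior (effDom u)).Nonempty := by
  by_contra h
  rw [Set.not_nonempty_iff_eq_empty] at h
  have hf := (convex_effDom hubot huconv).addHaar_frontier volume
  have h0 : volume (effDom u) = 0 := by
    refine measure_mono_null (fun x hx => ?_) hf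
    rw [frontier, h, Set.sdiff_empty]
    exact subset_closure hx
  have : ∫ x, expNegDensity u x = 0 := by
    refine integral_eq_zero_of_ae ?_
    have h1 : ∀ᵐ x, x ∉ effDom u := measure_eq_zero_iff_ae_notMem.1 h0
    filter_upwards [h1] with x hx using expNegDensity_of_notMem hx
  rw [this] at hnorm
  exact zero_ne_one hnorm

/-- Almost every point of the effective domain is an interior point of differentiability. -/
theorem ae_mem_interior_differentiableAt (hubot : ∀ x, u x ≠ ⊥) (huconv : EConvexOn u) :
    ∀ᵐ x, x ∈ effDom u → x ∈ interior (effDom u) ∧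
      DifferentiableAt ℝ (fun y => (u y).toReal) x := by
  have h1 : ∀ᵐ x, x ∉ frontier (effDom u) := measure_eq_zero_iff_ae_notMem.1
    ((convex_effDom hubot huconv).addHaar_frontier volume)
  filter_upwards [h1, (convexOn_toReal hubot huconv).ae_differentiableAt_interior (ν := volume)]
    with x h1 h2 hx
  have : x ∈ interior (effDom u) := by
    by_contra h
    exact h1 ⟨subset_closure hx, h⟩
  exact ⟨this, h2 this⟩

theorem integrable_expNegDensity (hnorm : ∫ x, expNegDensity u x = 1) :
    Integrable (expNegDensity u) := by
  by_contra h
  rw [integral_undef h] at hnorm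
  exact zero_ne_one hnorm

theorem lintegral_expNegDensity (hnorm : ∫ x, expNegDensity u x = 1) :
    ∫⁻ x, ENNReal.ofReal (expNegDensity u x) = 1 := by
  rw [← ofReal_integral_eq_lintegral_ofReal (integrable_expNegDensity hnorm)
    (Eventually.of_forall expNegDensity_nonneg), hnorm, ENNReal.ofReal_one]

/-- The probability measure `e^{-u} dx`. -/
def expNegMeasure (u : Ed d → EReal) : Measure (Ed d) :=
  volume.withDensity fun x => ENNReal.ofReal (expNegDensity u x)

theorem isProbabilityMeasure_expNegMeasure (hnorm : ∫ x, expNegDensity u x = 1) :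
    IsProbabilityMeasure (expNegMeasure u) :=
  ⟨by rw [expNegMeasure, withDensity_apply _ MeasurableSet.univ, Measure.restrict_univ,
    lintegral_expNegDensity hnorm]⟩

theorem ae_expNegMeasure_iff (hulsc : LowerSemicontinuous u) {p : Ed d → Prop} :
    (∀ᵐ x ∂(expNegMeasure u), p x) ↔ ∀ᵐ x, x ∈ effDom u → p x := by
  rw [expNegMeasure, ae_withDensity_iff (measurable_expNegDensity hulsc).ennreal_ofReal]
  simp only [ne_eq, ENNReal.ofReal_eq_zero, not_le, expNegDensity_pos_iff]

theorem integrable_expNegMeasure_iff (hulsc : LowerSemicontinuous u) {F : Type*}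
    [NormedAddCommGroup F] [NormedSpace ℝ F] {φ : Ed d → F} :
    Integrable φ (expNegMeasure u) ↔ Integrable fun x => expNegDensity u x • φ x := by
  have := integrable_withDensity_iff_integrable_smul' (μ := volume) (g := φ)
    (measurable_expNegDensity hulsc).ennreal_ofReal
    (Eventually.of_forall fun x => ENNReal.ofReal_lt_top)
  rw [expNegMeasure, this]
  simp only [ENNReal.toReal_ofReal (expNegDensity_nonneg _)]

theorem integral_expNegMeasure (hulsc : LowerSemicontinuous u) {F : Type*}
    [NormedAddCommGroup F] [NormedSpace ℝ F] (φ : Ed d → F) :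
    ∫ x, φ x ∂(expNegMeasure u) = ∫ x, expNegDensity u x • φ x := by
  have := integral_withDensity_eq_integral_toReal_smul (μ := volume)
    (measurable_expNegDensity hulsc).ennreal_ofReal
    (Eventually.of_forall fun x => ENNReal.ofReal_lt_top) φ
  rw [expNegMeasure, this]
  simp only [ENNReal.toReal_ofReal (expNegDensity_nonneg _)]

end ConvexBasics

section Growth

variable {d : ℕ} {u : Ed d → EReal}

theorem Convex.isBounded_of_measure_lt_top {E : Type*} [NormedAddCommGroup E] [NormedSpace ℝ E]
    [FiniteDimensional ℝ E] [MeasurableSpace E] [BorelSpace E] {ν : Measure E}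
    [ν.IsAddHaarMeasure] {K : Set E} (hK : Convex ℝ K) {x₀ : E} {r : ℝ} (hr : 0 < r)
    (hball : Metric.ball x₀ r ⊆ K) (hfin : ν K < ∞) : Bornology.IsBounded K := by
  by_contra hb
  obtain ⟨s, hsK, hs⟩ := exists_seq_of_forall_finset_exists (· ∈ K)
    (fun x y => 2 * r ≤ dist y x) fun t _ => by
      by_contra! hcon
      refine hb (Bornology.IsBounded.subset
        ((Bornology.isBounded_biUnion_finset t (f := fun x => Metric.ball x (2 * r))).2
          fun x _ => Metric.isBounded_ball) fun y hy => ?_)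
      obtain ⟨x, hx, hxy⟩ := hcon y hy
      exact Set.mem_biUnion (Finset.mem_coe.2 hx) (Metric.mem_ball.2 hxy)
  have hsub : ⋃ n, Metric.ball ((2⁻¹ : ℝ) • x₀ + (2⁻¹ : ℝ) • s n) (r / 2) ⊆ K := by
    refine Set.iUnion_subset fun n y hy => ?_
    rw [Metric.mem_ball, dist_eq_norm] at hy
    have hz : (2 : ℝ) • y - s n ∈ K := by
      refine hball ?_
      rw [Metric.mem_ball, dist_eq_norm]
      have : (2 : ℝ) • y - s n - x₀ = (2 : ℝ) • (y - ((2⁻¹ : ℝ) • x₀ + (2⁻¹ : ℝ) • s n)) := by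
        module
      rw [this, norm_smul, Real.norm_ofNat]
      linarith
    have := hK hz (hsK n) (a := 2⁻¹) (b := 2⁻¹) (by norm_num) (by norm_num) (by norm_num)
    convert this using 1
    module
  have hdisj : Pairwise (Function.onFun Disjoint
      fun n => Metric.ball ((2⁻¹ : ℝ) • x₀ + (2⁻¹ : ℝ) • s n) (r / 2)) := by
    have key : ∀ m n, m < n → Disjoint
        (Metric.ball ((2⁻¹ : ℝ) • x₀ + (2⁻¹ : ℝ) • s m) (r / 2))
        (Metric.ball ((2⁻¹ : ℝ) • x₀ + (2⁻¹ : ℝ) • s n) (r / 2)) := fun m n hmn => by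
      refine Metric.ball_disjoint_ball ?_
      have h := hs m n hmn
      rw [dist_eq_norm] at h ⊢
      have : (2⁻¹ : ℝ) • x₀ + (2⁻¹ : ℝ) • s m - ((2⁻¹ : ℝ) • x₀ + (2⁻¹ : ℝ) • s n) =
        -((2⁻¹ : ℝ) • (s n - s m)) := by module
      rw [this, norm_neg, norm_smul, norm_inv, Real.norm_ofNat]
      linarith
    intro m n hmn
    rcases lt_or_gt_of_ne hmn with h | h
    · exact key m n h
    · exact (key n m h).symm
  have hle := (measure_mono (μ := ν) hsub).trans_lt hfin
  rw [measure_iUnion hdisj fun n => measurableSet_ball] at hle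
  simp only [Measure.addHaar_ball_center] at hle
  rw [ENNReal.tsum_const_eq_top_of_ne_zero] at hle
  · exact lt_irrefl _ hle
  · exact (Metric.measure_ball_pos ν 0 (by positivity)).ne'

/-- A convex function with integrable `e^{-u}` grows at least linearly. -/
theorem exists_linear_growth (hubot : ∀ x, u x ≠ ⊥) (huconv : EConvexOn u)
    (hulsc : LowerSemicontinuous u) (hnorm : ∫ x, expNegDensity u x = 1) :
    ∃ a > 0, ∃ b ≥ 0, ∀ x ∈ effDom u, a * ‖x‖ - b ≤ (u x).toReal := by
  obtain ⟨x₀, hx₀⟩ := interior_effDom_nonempty hubot huconv hnorm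
  have hc := convexOn_toReal hubot huconv
  have hcont : ContinuousAt (fun x => (u x).toReal) x₀ :=
    hc.continuousOn_interior.continuousAt (isOpen_interior.mem_nhds hx₀)
  set M := (u x₀).toReal + 1 with hM
  have hnear : ∀ᶠ x in 𝓝 x₀, (u x).toReal < M ∧ x ∈ effDom u :=
    (hcont.eventually_lt_const (by simp [hM])).and (mem_interior_iff_mem_nhds.1 hx₀)
  obtain ⟨r, hr, hball⟩ := Metric.eventually_nhds_iff_ball.1 hnear
  set K : Set (Ed d) := {x | x ∈ effDom u ∧ (u x).toReal ≤ M + 1} with hKdef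
  have hKc : Convex ℝ K := hc.convex_le _
  have hKfin : volume K < ∞ := by
    have h1 := mul_meas_ge_le_lintegral (μ := volume)
      (measurable_expNegDensity hulsc).ennreal_ofReal (ENNReal.ofReal (Real.exp (-(M + 1))))
    rw [lintegral_expNegDensity hnorm] at h1
    have h2 : K ⊆ {x | ENNReal.ofReal (Real.exp (-(M + 1))) ≤
        ENNReal.ofReal (expNegDensity u x)} := fun x hx => by
      refine ENNReal.ofReal_le_ofReal ?_
      rw [expNegDensity_of_mem hx.1]
      exact Real.exp_le_exp.2 (neg_le_neg hx.2)
    refine (measure_mono h2).trans_lt ?_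
    by_contra htop
    rw [not_lt_top_iff.1 htop, ENNReal.mul_top] at h1
    · exact absurd h1 (by simp)
    · simpa using Real.exp_pos _
  have hKb := hKc.isBounded_of_measure_lt_top (ν := volume) (x₀ := x₀) hr
    (fun x hx => ⟨(hball x hx).2, (hball x hx).1.le.trans (by linarith)⟩) hKfin
  obtain ⟨L, hL, hKL⟩ := hKb.subset_ball_lt 0 x₀
  obtain ⟨z, -, hz⟩ := (hulsc.lowerSemicontinuousOn _).exists_isMinOn
    (s := Metric.closedBall x₀ L) ⟨x₀, Metric.mem_closedBall_self hL.le⟩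
    (isCompact_closedBall x₀ L)
  have hx₀d : x₀ ∈ effDom u := interior_subset hx₀
  have hlow : ∀ x ∈ effDom u, min (u z).toReal (M - 1) - 1 + ‖x - x₀‖ / L ≤ (u x).toReal := by
    intro x hx
    rcases lt_or_ge ‖x - x₀‖ L with h | h
    · have h1 : u z ≤ u x := hz (by
        simp only [Metric.mem_closedBall, dist_eq_norm]; exact h.le)
      have h2 : (u z).toReal ≤ (u x).toReal := EReal.toReal_le_toReal h1 (hubot z) (ne_of_lt hx)
      have h3 : ‖x - x₀‖ / L ≤ 1 := (div_le_one hL).2 h.le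
      linarith [min_le_left (u z).toReal (M - 1)]
    · have hpos : 0 < ‖x - x₀‖ := hL.trans_le h
      set θ := L / ‖x - x₀‖ with hθ
      have hθ0 : 0 < θ := by positivity
      have hθ1 : θ ≤ 1 := (div_le_one hpos).2 h
      have hy : (1 - θ) • x₀ + θ • x ∈ effDom u :=
        hc.1 hx₀d hx (by linarith) hθ0.le (by ring)
      have hconv := hc.2 hx₀d hx (by linarith : 0 ≤ 1 - θ) hθ0.le (by ring)
      have hnot : (1 - θ) • x₀ + θ • x ∉ K := fun hmem => by
        have := hKL hmem
        rw [Metric.mem_ball, dist_eq_norm] at this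
        have e : (1 - θ) • x₀ + θ • x - x₀ = θ • (x - x₀) := by module
        rw [e, norm_smul, Real.norm_of_nonneg hθ0.le, hθ, div_mul_cancel₀ _ hpos.ne'] at this
        exact lt_irrefl _ this
      have hgt : M + 1 < (u ((1 - θ) • x₀ + θ • x)).toReal := by
        by_contra hcon
        exact hnot ⟨hy, not_lt.1 hcon⟩
      simp only [smul_eq_mul] at hconv
      have h4 : 1 ≤ θ * ((u x).toReal - (M - 1)) := by
        have : (u x₀).toReal = M - 1 := by simp [hM]
        rw [this] at hconv
        nlinarith
      have h5 : ‖x - x₀‖ / L * θ = 1 := by rw [hθ]; field_simp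
      have h6 : ‖x - x₀‖ / L ≤ (u x).toReal - (M - 1) := by
        by_contra hcon
        nlinarith [not_le.1 hcon]
      linarith [min_le_right (u z).toReal (M - 1)]
  refine ⟨1 / L, by positivity, |‖x₀‖ / L + 1 - min (u z).toReal (M - 1)|, abs_nonneg _,
    fun x hx => ?_⟩
  have h1 := hlow x hx
  have h2 : ‖x‖ / L - ‖x₀‖ / L ≤ ‖x - x₀‖ / L := by
    rw [← sub_div]
    exact div_le_div_of_nonneg_right (norm_sub_norm_le x x₀) hL.le
  have h3 := le_abs_self (‖x₀‖ / L + 1 - min (u z).toReal (M - 1))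
  have h4 : 1 / L * ‖x‖ = ‖x‖ / L := by ring
  linarith

theorem integrable_exp_neg_mul_norm {a : ℝ} (ha : 0 < a) :
    Integrable fun x : Ed d => Real.exp (-(a * ‖x‖)) := by
  have h := (integrable_one_add_norm (E := Ed d) (μ := volume) (r := (d + 1 : ℕ))
    (by simp)).const_mul (Real.exp a * ((d + 1).factorial / a ^ (d + 1)))
  refine h.mono' (by fun_prop) (Eventually.of_forall fun x => ?_)
  have hx : 0 < 1 + ‖x‖ := by positivity
  rw [Real.norm_of_nonneg (Real.exp_pos _).le, Real.rpow_neg hx.le, Real.rpow_natCast]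
  have h1 := Real.pow_div_factorial_le_exp (x := a * (1 + ‖x‖)) (by positivity) (d + 1)
  have h2 : Real.exp (-(a * ‖x‖)) = Real.exp a * (Real.exp (a * (1 + ‖x‖)))⁻¹ := by
    rw [← Real.exp_neg, ← Real.exp_add]; ring_nf
  rw [h2, mul_assoc]
  refine mul_le_mul_of_nonneg_left ?_ (Real.exp_pos _).le
  refine (inv_anti₀ (by positivity) h1).trans_eq ?_
  rw [mul_pow, inv_div]
  field_simp

theorem mul_exp_neg_le (t : ℝ) : t * Real.exp (-t) ≤ 2 * Real.exp (-(t / 2)) := by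
  have h1 : t ≤ 2 * Real.exp (t / 2) := by linarith [Real.add_one_le_exp (t / 2)]
  calc t * Real.exp (-t) ≤ 2 * Real.exp (t / 2) * Real.exp (-t) :=
        mul_le_mul_of_nonneg_right h1 (Real.exp_pos _).le
    _ = _ := by rw [mul_assoc, ← Real.exp_add]; ring_nf

/-- `e^{-u}` has exponential tails. -/
theorem expNegDensity_le {a b : ℝ} (hab : ∀ x ∈ effDom u, a * ‖x‖ - b ≤ (u x).toReal) (x : Ed d) :
    expNegDensity u x ≤ Real.exp b * Real.exp (-(a * ‖x‖)) := by
  by_cases hx : x ∈ effDom u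
  · rw [expNegDensity_of_mem hx, ← Real.exp_add]
    exact Real.exp_le_exp.2 (by linarith [hab x hx])
  · rw [expNegDensity_of_notMem hx]
    positivity

theorem firstMoment_expNegMeasure (hubot : ∀ x, u x ≠ ⊥) (huconv : EConvexOn u)
    (hulsc : LowerSemicontinuous u) (hnorm : ∫ x, expNegDensity u x = 1) :
    FirstMoment (expNegMeasure u) := by
  obtain ⟨a, ha, b, -, hab⟩ := exists_linear_growth hubot huconv hulsc hnorm
  rw [FirstMoment, integrable_expNegMeasure_iff hulsc]
  refine ((integrable_exp_neg_mul_norm (d := d) (half_pos ha)).const_mul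
    (Real.exp b * (2 / a))).mono'
    ((measurable_expNegDensity hulsc).smul measurable_norm).aestronglyMeasurable
    (Eventually.of_forall fun x => ?_)
  rw [smul_eq_mul, Real.norm_of_nonneg (mul_nonneg (expNegDensity_nonneg x) (norm_nonneg x))]
  have h1 := mul_exp_neg_le (a * ‖x‖)
  have h2 : ‖x‖ * Real.exp (-(a * ‖x‖)) ≤ 2 / a * Real.exp (-(a / 2 * ‖x‖)) := by
    rw [div_mul_eq_mul_div, le_div_iff₀ ha]
    calc _ = a * ‖x‖ * Real.exp (-(a * ‖x‖)) := by ring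
      _ ≤ _ := h1
      _ = _ := by ring_nf
  calc _ ≤ Real.exp b * Real.exp (-(a * ‖x‖)) * ‖x‖ :=
        mul_le_mul_of_nonneg_right (expNegDensity_le hab x) (norm_nonneg x)
    _ = Real.exp b * (‖x‖ * Real.exp (-(a * ‖x‖))) := by ring
    _ ≤ Real.exp b * (2 / a * Real.exp (-(a / 2 * ‖x‖))) :=
        mul_le_mul_of_nonneg_left h2 (Real.exp_pos _).le
    _ = _ := by ring

theorem integrable_toReal_expNegMeasure (hubot : ∀ x, u x ≠ ⊥) (huconv : EConvexOn u)
    (hulsc : LowerSemicontinuous u) (hnorm : ∫ x, expNegDensity u x = 1) :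
    Integrable (fun x => (u x).toReal) (expNegMeasure u) := by
  obtain ⟨a, ha, b, hb, hab⟩ := exists_linear_growth hubot huconv hulsc hnorm
  rw [integrable_expNegMeasure_iff hulsc]
  refine ((integrable_exp_neg_mul_norm (d := d) (half_pos ha)).const_mul
    ((2 + b * Real.exp (b / 2)) * Real.exp (b / 2))).mono'
    ((measurable_expNegDensity hulsc).smul
      hulsc.measurable.ereal_toReal).aestronglyMeasurable
    (Eventually.of_forall fun x => ?_)
  by_cases hx : x ∈ effDom u
  swap
  · rw [expNegDensity_of_notMem hx, zero_smul, norm_zero]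
    positivity
  rw [expNegDensity_of_mem hx, norm_smul, Real.norm_of_nonneg (Real.exp_pos _).le, Real.norm_eq_abs]
  set t := (u x).toReal
  have ht : a * ‖x‖ - b ≤ t := hab x hx
  have htb : -b ≤ t := by nlinarith [norm_nonneg x]
  have h1 : Real.exp (-t) * |t| ≤ (2 + b * Real.exp (b / 2)) * Real.exp (-(t / 2)) := by
    rcases le_total 0 t with h | h
    · rw [abs_of_nonneg h, mul_comm]
      refine (mul_exp_neg_le t).trans ?_
      have : 0 ≤ b * Real.exp (b / 2) * Real.exp (-(t / 2)) := by positivity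
      linarith
    · have h2 : Real.exp (-t) = Real.exp (-(t / 2)) * Real.exp (-(t / 2)) := by
        rw [← Real.exp_add]; ring_nf
      have h3 : Real.exp (-(t / 2)) ≤ Real.exp (b / 2) := Real.exp_le_exp.2 (by linarith)
      have h4 : |t| ≤ b := abs_le.2 ⟨htb, h.trans hb⟩
      calc Real.exp (-t) * |t| ≤ Real.exp (-(t / 2)) * Real.exp (b / 2) * b := by
            rw [h2]; gcongr
        _ ≤ _ := by nlinarith [Real.exp_pos (-(t / 2))]
  refine h1.trans ?_
  rw [mul_assoc]
  refine mul_le_mul_of_nonneg_left ?_ (by positivity)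
  rw [← Real.exp_add]
  exact Real.exp_le_exp.2 (by linarith)

end Growth

section ExtendedIntegral

variable {α : Type*} [MeasurableSpace α] {ν : Measure α}

/-- The extended-real-valued integral: positive part minus negative part. -/
def eintegral (ν : Measure α) (φ : α → ℝ) : EReal :=
  ((∫⁻ x, ENNReal.ofReal (φ x) ∂ν : ℝ≥0∞) : EReal) -
    ((∫⁻ x, ENNReal.ofReal (-φ x) ∂ν : ℝ≥0∞) : EReal)

theorem eintegral_mono_ae {φ ψ : α → ℝ} (h : φ ≤ᵐ[ν] ψ) : eintegral ν φ ≤ eintegral ν ψ := by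
  refine EReal.sub_le_sub ?_ ?_
  · exact_mod_cast lintegral_mono_ae (h.mono fun x hx => ENNReal.ofReal_le_ofReal hx)
  · exact_mod_cast lintegral_mono_ae (h.mono fun x hx =>
      ENNReal.ofReal_le_ofReal (neg_le_neg hx))

theorem eintegral_congr_ae {φ ψ : α → ℝ} (h : φ =ᵐ[ν] ψ) : eintegral ν φ = eintegral ν ψ :=
  le_antisymm (eintegral_mono_ae h.le) (eintegral_mono_ae h.symm.le)

theorem eintegral_eq_integral {φ : α → ℝ} (h : Integrable φ ν) :
    eintegral ν φ = ((∫ x, φ x ∂ν : ℝ) : EReal) := by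
  have h1 : ∫⁻ x, ENNReal.ofReal (φ x) ∂ν ≠ ∞ := h.lintegral_lt_top.ne
  have h2 : ∫⁻ x, ENNReal.ofReal (-φ x) ∂ν ≠ ∞ := h.neg.lintegral_lt_top.ne
  rw [integral_eq_lintegral_pos_part_sub_lintegral_neg_part h, eintegral, EReal.coe_sub,
    EReal.coe_ennreal_toReal h1, EReal.coe_ennreal_toReal h2]

end ExtendedIntegral

section UpperBound

variable {d : ℕ} {u : Ed d → EReal} {μ : Measure (Ed d)}

theorem entropy_of_ac {ρ : Measure (Ed d)} (h : ρ ≪ volume) :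
    entropy ρ = eintegral volume fun x =>
      (ρ.rnDeriv volume x).toReal * Real.log (ρ.rnDeriv volume x).toReal :=
  if_pos h

theorem entropy_expNegMeasure (hubot : ∀ x, u x ≠ ⊥) (huconv : EConvexOn u)
    (hulsc : LowerSemicontinuous u) (hnorm : ∫ x, expNegDensity u x = 1) :
    entropy (expNegMeasure u) = ((-∫ x, (u x).toReal ∂(expNegMeasure u) : ℝ) : EReal) := by
  have hint := integrable_toReal_expNegMeasure hubot huconv hulsc hnorm
  have hint' : Integrable fun x => -(expNegDensity u x • (u x).toReal) :=
    ((integrable_expNegMeasure_iff hulsc).1 hint).neg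
  rw [integral_expNegMeasure hulsc, ← integral_neg, ← eintegral_eq_integral hint',
    entropy_of_ac (by exact withDensity_absolutelyContinuous _ _)]
  refine eintegral_congr_ae ?_
  filter_upwards [Measure.rnDeriv_withDensity volume
    (measurable_expNegDensity hulsc).ennreal_ofReal] with x hx
  rw [expNegMeasure, hx, ENNReal.toReal_ofReal (expNegDensity_nonneg x)]
  by_cases hx : x ∈ effDom u
  · rw [expNegDensity_of_mem hx, Real.log_exp]
    simp
  · simp [expNegDensity_of_notMem hx]

theorem integrable_realGradient (hμ1 : FirstMoment μ)
    (hpush : (expNegMeasure u).map (realGradient u) = μ) :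
    Integrable (realGradient u) (expNegMeasure u) := by
  rw [FirstMoment, ← hpush, integrable_map_measure (by fun_prop)
    measurable_realGradient.aemeasurable] at hμ1
  exact (integrable_norm_iff measurable_realGradient.aestronglyMeasurable).1 hμ1

theorem integral_realGradient (hμc : Centered μ)
    (hpush : (expNegMeasure u).map (realGradient u) = μ) :
    ∫ x, realGradient u x ∂(expNegMeasure u) = 0 := by
  rw [Centered, ← hpush, integral_map measurable_realGradient.aemeasurable (by fun_prop)] at hμc
  exact hμc

/-- The integral of the dilation of `e^{-u}` by the factor `c` around a point. -/
theorem integral_expNegDensity_dilation (hnorm : ∫ x, expNegDensity u x = 1) (x₀ : Ed d) {c : ℝ}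
    (hc : 0 < c) :
    ∫ x, expNegDensity u (x₀ + c • (x - x₀)) = (c ^ d)⁻¹ := by
  rw [integral_sub_right_eq_self (fun z => expNegDensity u (x₀ + c • z)) x₀,
    Measure.integral_comp_smul volume (fun z => expNegDensity u (x₀ + z)) c,
    integral_add_left_eq_self (fun z => expNegDensity u z) x₀, hnorm, finrank_euclideanSpace,
    Fintype.card_fin, smul_eq_mul, mul_one, abs_of_pos (by positivity)]

theorem expNegDensity_dilation_le (hubot : ∀ x, u x ≠ ⊥) (huconv : EConvexOn u) {x x₀ : Ed d}
    (hx : x ∈ effDom u) (hd : DifferentiableAt ℝ (fun y => (u y).toReal) x) (ε : ℝ) :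
    expNegDensity u (x₀ + (1 + ε) • (x - x₀)) ≤
      expNegDensity u x * Real.exp (-(ε * ⟪x - x₀, realGradient u x⟫)) := by
  by_cases hy : x₀ + (1 + ε) • (x - x₀) ∈ effDom u
  · rw [expNegDensity_of_mem hx, expNegDensity_of_mem hy, ← Real.exp_add, Real.exp_le_exp]
    have h := tangent_le hubot huconv hx hy hd
    have e : x₀ + (1 + ε) • (x - x₀) - x = ε • (x - x₀) := by module
    rw [e, real_inner_smul_left] at h
    linarith
  · rw [expNegDensity_of_notMem hy]
    exact mul_nonneg (expNegDensity_nonneg x) (Real.exp_pos _).le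

theorem one_sub_inv_pow_le (n : ℕ) {ε : ℝ} (hε : 0 < ε) :
    1 - ((1 + ε) ^ n)⁻¹ ≤ n * ε := by
  have h := one_add_mul_le_pow (a := -(ε / (1 + ε))) (by
    have : ε / (1 + ε) ≤ 1 := (div_le_one (by positivity)).2 (by linarith)
    linarith) n
  have e : 1 + -(ε / (1 + ε)) = (1 + ε)⁻¹ := by field_simp; ring
  rw [e, inv_pow] at h
  have h2 : ε / (1 + ε) ≤ ε := div_le_self hε.le (by linarith)
  nlinarith [(Nat.cast_nonneg n : (0 : ℝ) ≤ n)]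

theorem neg_le_one_sub_exp_div {C ε s : ℝ} (hC : 0 ≤ C) (hs : -C ≤ s) (hε : 0 < ε) (hε1 : ε ≤ 1) :
    0 ≤ (1 - Real.exp (-(ε * s))) / ε + C * Real.exp C := by
  rw [div_add' _ _ _ hε.ne']
  refine div_nonneg ?_ hε.le
  have h1 : 1 - Real.exp (-(ε * s)) = - (Real.exp (-(ε * s)) - 1) := by ring
  rcases le_total 0 s with h | h
  · have : Real.exp (-(ε * s)) ≤ 1 := Real.exp_le_one_iff.2 (by nlinarith)
    have : 0 ≤ C * Real.exp C * ε := by positivity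
    linarith
  · set t := -(ε * s) with ht
    have ht0 : 0 ≤ t := by nlinarith
    have htC : t ≤ ε * C := by nlinarith
    have htC' : t ≤ C := by nlinarith
    have h2 : Real.exp t - 1 ≤ t * Real.exp t := by
      have := Real.add_one_le_exp (-t)
      have h3 : Real.exp (-t) * Real.exp t = 1 := by rw [← Real.exp_add]; simp
      nlinarith [Real.exp_pos t]
    have h4 : t * Real.exp t ≤ ε * C * Real.exp C := by gcongr
    linarith

theorem tendsto_one_sub_exp_div (s : ℝ) :
    Tendsto (fun n : ℕ => (1 - Real.exp (-(1 / ((n : ℝ) + 1) * s))) / (1 / ((n : ℝ) + 1)))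
      atTop (𝓝 s) := by
  have hder : HasDerivAt (fun t : ℝ => 1 - Real.exp (-(t * s))) s 0 := by
    have h1 : HasDerivAt (fun t : ℝ => -(t * s)) (-s) 0 := by
      simpa using ((hasDerivAt_id (0 : ℝ)).mul_const s).fun_neg
    simpa using (h1.exp).const_sub 1
  have h2 := hder.tendsto_slope_zero
  have h3 : Tendsto (fun n : ℕ => 1 / ((n : ℝ) + 1)) atTop (𝓝[≠] 0) :=
    tendsto_nhdsWithin_iff.2 ⟨tendsto_one_div_add_atTop_nhds_zero_nat,
      Eventually.of_forall fun n => by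
        have : (1 : ℝ) / ((n : ℝ) + 1) ≠ 0 := by positivity
        exact this⟩
  refine (h2.comp h3).congr fun n => ?_
  simp only [Function.comp_apply, zero_add, zero_mul, neg_zero, Real.exp_zero, sub_self, sub_zero,
    smul_eq_mul, div_eq_inv_mul]

theorem integrable_inner_sub_realGradient (hubot : ∀ x, u x ≠ ⊥) (huconv : EConvexOn u)
    (hulsc : LowerSemicontinuous u) (hnorm : ∫ x, expNegDensity u x = 1)
    {x₀ : Ed d} (hx₀ : x₀ ∈ effDom u) :
    Integrable (fun x => ⟪x - x₀, realGradient u x⟫) (expNegMeasure u) ∧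
      ∫ x, ⟪x - x₀, realGradient u x⟫ ∂(expNegMeasure u) ≤ d := by
  have := isProbabilityMeasure_expNegMeasure hnorm
  obtain ⟨a, ha, b, hb, hab⟩ := exists_linear_growth hubot huconv hulsc hnorm
  set s : Ed d → ℝ := fun x => ⟪x - x₀, realGradient u x⟫ with hs
  have hsm : Measurable s := by
    exact (measurable_id.sub_const x₀).inner measurable_realGradient
  set C := b + |(u x₀).toReal| with hCdef
  have hC : 0 ≤ C := by positivity
  have hgood := (ae_expNegMeasure_iff (u := u) hulsc
    (p := fun x => x ∈ effDom u ∧ DifferentiableAt ℝ (fun y => (u y).toReal) x)).2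
    ((ae_mem_interior_differentiableAt hubot huconv).mono fun x h hx => ⟨hx, (h hx).2⟩)
  have hlow : ∀ᵐ x ∂(expNegMeasure u), -C ≤ s x := by
    filter_upwards [hgood] with x hx
    have h1 := tangent_le hubot huconv hx.1 hx₀ hx.2
    have h2 : ⟪x₀ - x, realGradient u x⟫ = - s x := by
      rw [hs, ← inner_neg_left, neg_sub]
    have h3 := hab x hx.1
    have h4 := le_abs_self (u x₀).toReal
    have h5 : 0 ≤ a * ‖x‖ := by positivity
    linarith
  set h : ℕ → Ed d → ℝ := fun n x =>
    (1 - Real.exp (-(1 / ((n : ℝ) + 1) * s x))) / (1 / ((n : ℝ) + 1)) + C * Real.exp C with hh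
  have hε : ∀ n : ℕ, (0 : ℝ) < 1 / ((n : ℝ) + 1) ∧ 1 / ((n : ℝ) + 1) ≤ 1 := fun n =>
    ⟨by positivity, (div_le_one (by positivity)).2 (by linarith [(Nat.cast_nonneg n : (0 : ℝ) ≤ n)])⟩
  have hh0 : ∀ n, 0 ≤ᵐ[expNegMeasure u] h n := fun n => by
    filter_upwards [hlow] with x hx
    exact neg_le_one_sub_exp_div hC hx (hε n).1 (hε n).2
  have hhm : ∀ n, Measurable (h n) := fun n =>
    (((hsm.const_mul _).neg.exp.const_sub 1).div_const _).add_const _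
  have hexpint : ∀ n : ℕ, Integrable (fun x => Real.exp (-(1 / ((n : ℝ) + 1) * s x)))
      (expNegMeasure u) := fun n => by
    refine Integrable.of_bound ((hsm.const_mul _).neg.exp).aestronglyMeasurable (Real.exp C) ?_
    filter_upwards [hlow] with x hx
    rw [Real.norm_of_nonneg (Real.exp_pos _).le, Real.exp_le_exp]
    nlinarith [(hε n).1, (hε n).2]
  have hexple : ∀ n : ℕ, ((1 + 1 / ((n : ℝ) + 1)) ^ d)⁻¹ ≤
      ∫ x, Real.exp (-(1 / ((n : ℝ) + 1) * s x)) ∂(expNegMeasure u) := fun n => by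
    rw [← integral_expNegDensity_dilation hnorm x₀ (by have := (hε n).1; linarith),
      integral_expNegMeasure hulsc]
    refine integral_mono_of_nonneg (Eventually.of_forall fun x => expNegDensity_nonneg _)
      ((integrable_expNegMeasure_iff hulsc).1 (hexpint n)) ?_
    filter_upwards [ae_mem_interior_differentiableAt hubot huconv] with x hx
    by_cases hxd : x ∈ effDom u
    · exact expNegDensity_dilation_le hubot huconv hxd (hx hxd).2 _
    · rw [expNegDensity_of_notMem hxd, zero_smul, expNegDensity_of_notMem fun hy => hxd ?_]
      have hl := (hε n).1
      set l := 1 + 1 / ((n : ℝ) + 1) with hldef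
      have hl1 : 1 < l := by linarith
      have := convex_effDom hubot huconv hx₀ hy
        (sub_nonneg.2 (inv_le_one_of_one_le₀ hl1.le)) (by positivity) (sub_add_cancel 1 l⁻¹)
      convert this using 1
      rw [smul_add, smul_smul, inv_mul_cancel₀ (by linarith)]
      module
  have hhint : ∀ n, ∫⁻ x, ENNReal.ofReal (h n x) ∂(expNegMeasure u) ≤
      ENNReal.ofReal (d + C * Real.exp C) := fun n => by
    have hi0 : Integrable (fun x => (1 - Real.exp (-(1 / ((n : ℝ) + 1) * s x))) /
        (1 / ((n : ℝ) + 1))) (expNegMeasure u) :=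
      ((integrable_const (1 : ℝ)).sub (hexpint n)).div_const _
    have hi : Integrable (h n) (expNegMeasure u) := hi0.add (integrable_const _)
    rw [← ofReal_integral_eq_lintegral_ofReal hi (hh0 n)]
    refine ENNReal.ofReal_le_ofReal ?_
    simp only [hh]
    rw [integral_add hi0 (integrable_const _), integral_div, integral_sub (integrable_const _) (hexpint n)]
    simp only [integral_const, probReal_univ, smul_eq_mul, one_mul]
    refine add_le_add_left ?_ _
    rw [div_le_iff₀ (hε n).1]
    linarith [one_sub_inv_pow_le d (hε n).1, hexple n]
  have hlim : ∫⁻ x, ENNReal.ofReal (s x + C * Real.exp C) ∂(expNegMeasure u) ≤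
      ENNReal.ofReal (d + C * Real.exp C) := by
    calc _ = ∫⁻ x, liminf (fun n => ENNReal.ofReal (h n x)) atTop ∂(expNegMeasure u) := by
          refine lintegral_congr fun x => ?_
          exact (((ENNReal.continuous_ofReal.tendsto _).comp
            ((tendsto_one_sub_exp_div (s x)).add_const _)).liminf_eq).symm
      _ ≤ liminf (fun n => ∫⁻ x, ENNReal.ofReal (h n x) ∂(expNegMeasure u)) atTop :=
          lintegral_liminf_le fun n => (hhm n).ennreal_ofReal
      _ ≤ liminf (fun _ : ℕ => ENNReal.ofReal (d + C * Real.exp C)) atTop :=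
          liminf_le_liminf (Eventually.of_forall hhint)
      _ = _ := liminf_const _
  have hpos : 0 ≤ᵐ[expNegMeasure u] fun x => s x + C * Real.exp C := by
    filter_upwards [hlow] with x hx
    have : C ≤ C * Real.exp C := le_mul_of_one_le_right hC (Real.one_le_exp hC)
    show 0 ≤ s x + C * Real.exp C
    linarith
  have hint : Integrable (fun x => s x + C * Real.exp C) (expNegMeasure u) :=
    (lintegral_ofReal_ne_top_iff_integrable (hsm.add_const _).aestronglyMeasurable hpos).1
      (hlim.trans_lt ENNReal.ofReal_lt_top).ne
  have hints : Integrable s (expNegMeasure u) := by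
    refine (hint.sub (integrable_const (C * Real.exp C))).congr (Eventually.of_forall fun x => ?_)
    simp
  refine ⟨hints, ?_⟩
  rw [← ofReal_integral_eq_lintegral_ofReal hint hpos,
    ENNReal.ofReal_le_ofReal_iff (by positivity), integral_add hints (integrable_const _)] at hlim
  simp only [integral_const, probReal_univ, one_smul] at hlim
  linarith

end UpperBound

section Fenchel

variable {d : ℕ} {u : Ed d → EReal} {μ : Measure (Ed d)}

theorem integrable_inner_realGradient (hubot : ∀ x, u x ≠ ⊥) (huconv : EConvexOn u)
    (hulsc : LowerSemicontinuous u) (hnorm : ∫ x, expNegDensity u x = 1)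
    (hμ1 : FirstMoment μ) (hμc : Centered μ)
    (hpush : (expNegMeasure u).map (realGradient u) = μ) :
    Integrable (fun x => ⟪x, realGradient u x⟫) (expNegMeasure u) ∧
      ∫ x, ⟪x, realGradient u x⟫ ∂(expNegMeasure u) ≤ d := by
  obtain ⟨x₀, hx₀⟩ := interior_effDom_nonempty hubot huconv hnorm
  obtain ⟨h1, h2⟩ := integrable_inner_sub_realGradient hubot huconv hulsc hnorm
    (interior_subset hx₀)
  have hg := integrable_realGradient hμ1 hpush
  have h3 : Integrable (fun x => ⟪x₀, realGradient u x⟫) (expNegMeasure u) := hg.const_inner x₀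
  have e : (fun x => ⟪x, realGradient u x⟫) =
      fun x => ⟪x - x₀, realGradient u x⟫ + ⟪x₀, realGradient u x⟫ := by
    ext x
    rw [inner_sub_left]
    ring
  rw [e]
  refine ⟨h1.add h3, ?_⟩
  rw [integral_add h1 h3, integral_inner hg, integral_realGradient hμc hpush, inner_zero_right,
    add_zero]
  exact h2

theorem measurable_legendre : Measurable (legendre u) := by
  refine LowerSemicontinuous.measurable (lowerSemicontinuous_iSup fun x => ?_)
  refine Continuous.lowerSemicontinuous ?_
  have h1 : Continuous fun y : Ed d => ((⟪x, y⟫ : ℝ) : EReal) :=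
    continuous_coe_real_ereal.comp (by fun_prop)
  induction h : u x with
  | bot => simpa using continuous_const
  | top => simpa using continuous_const
  | coe r =>
    have : (fun y : Ed d => ((⟪x, y⟫ : ℝ) : EReal) - (r : EReal)) =
        fun y => ((⟪x, y⟫ - r : ℝ) : EReal) := by ext y; simp
    rw [this]
    exact continuous_coe_real_ereal.comp (by fun_prop)

theorem legendre_realGradient (hubot : ∀ x, u x ≠ ⊥) (huconv : EConvexOn u) {x : Ed d}
    (hx : x ∈ effDom u) (hd : DifferentiableAt ℝ (fun y => (u y).toReal) x) :
    legendre u (realGradient u x) = ((⟪x, realGradient u x⟫ - (u x).toReal : ℝ) : EReal) := by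
  refine le_antisymm (iSup_le fun y => ?_) (le_iSup_of_le x ?_)
  · by_cases hy : y ∈ effDom u
    · have h := tangent_le hubot huconv hx hy hd
      rw [← coe_toReal_of_mem_effDom hubot hy, ← EReal.coe_sub, EReal.coe_le_coe_iff]
      rw [inner_sub_left] at h
      linarith
    · rw [show u y = ⊤ from not_lt_top_iff.1 hy, EReal.sub_top]
      exact bot_le
  · rw [← EReal.coe_toReal (ne_of_lt hx) (hubot x), ← EReal.coe_sub, EReal.toReal_coe]

theorem inner_le_add_legendre (hubot : ∀ x, u x ≠ ⊥) {x y : Ed d} (hx : x ∈ effDom u)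
    (hy : legendre u y < ⊤) : ⟪x, y⟫ ≤ (u x).toReal + (legendre u y).toReal := by
  have h : ((⟪x, y⟫ : ℝ) : EReal) - u x ≤ legendre u y := le_iSup
    (fun x : Ed d => (((⟪x, y⟫ : ℝ) : EReal) - u x)) x
  rw [← coe_toReal_of_mem_effDom hubot hx, ← EReal.coe_sub] at h
  have hb : legendre u y ≠ ⊥ := fun hb => by
    rw [hb] at h
    exact absurd (le_bot_iff.1 h) (EReal.coe_ne_bot _)
  rw [← EReal.coe_toReal hy.ne hb, EReal.coe_le_coe_iff] at h
  linarith

theorem maxCorr_expNegMeasure_le (hubot : ∀ x, u x ≠ ⊥) (huconv : EConvexOn u)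
    (hulsc : LowerSemicontinuous u) (hnorm : ∫ x, expNegDensity u x = 1)
    (hμ1 : FirstMoment μ) (hμc : Centered μ)
    (hpush : (expNegMeasure u).map (realGradient u) = μ) :
    maxCorr (expNegMeasure u) μ ≤ ((d : ℝ) : EReal) := by
  obtain ⟨h1, h2⟩ := integrable_inner_realGradient hubot huconv hulsc hnorm hμ1 hμc hpush
  have hu := integrable_toReal_expNegMeasure hubot huconv hulsc hnorm
  have hgood := (ae_expNegMeasure_iff (u := u) hulsc
    (p := fun x => x ∈ effDom u ∧ DifferentiableAt ℝ (fun y => (u y).toReal) x)).2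
    ((ae_mem_interior_differentiableAt hubot huconv).mono fun x h hx => ⟨hx, (h hx).2⟩)
  have hleg : (fun x => (legendre u (realGradient u x)).toReal) =ᵐ[expNegMeasure u]
      fun x => ⟪x, realGradient u x⟫ - (u x).toReal := by
    filter_upwards [hgood] with x hx
    rw [legendre_realGradient hubot huconv hx.1 hx.2, EReal.toReal_coe]
  have hψm : Measurable fun y => (legendre u y).toReal := measurable_legendre.ereal_toReal
  have hψ : Integrable (fun y => (legendre u y).toReal) μ := by
    rw [← hpush, integrable_map_measure hψm.aestronglyMeasurable
      measurable_realGradient.aemeasurable]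
    exact (h1.sub hu).congr hleg.symm
  have hψint : ∫ y, (legendre u y).toReal ∂μ = ∫ x, ⟪x, realGradient u x⟫ ∂(expNegMeasure u) -
      ∫ x, (u x).toReal ∂(expNegMeasure u) := by
    rw [← hpush, integral_map measurable_realGradient.aemeasurable hψm.aestronglyMeasurable,
      ← integral_sub h1 hu]
    exact integral_congr_ae hleg
  have hψfin : ∀ᵐ y ∂μ, legendre u y < ⊤ := by
    rw [← hpush, ae_map_iff measurable_realGradient.aemeasurable
      (measurableSet_lt measurable_legendre measurable_const)]
    filter_upwards [hgood] with x hx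
    rw [legendre_realGradient hubot huconv hx.1 hx.2]
    exact EReal.coe_lt_top _
  refine iSup₂_le fun γ ⟨_, hγ1, hγ2⟩ => ?_
  have hfst : ∀ᵐ p ∂γ, p.1 ∈ effDom u :=
    ae_of_ae_map (f := Prod.fst) measurable_fst.aemeasurable (p := fun x => x ∈ effDom u)
      (by rw [← Measure.fst, hγ1]; exact hgood.mono fun x hx => hx.1)
  have hsnd : ∀ᵐ p ∂γ, legendre u p.2 < ⊤ :=
    ae_of_ae_map (f := Prod.snd) measurable_snd.aemeasurable (p := fun y => legendre u y < ⊤)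
      (by rw [← Measure.snd, hγ2]; exact hψfin)
  have hu' : Integrable (fun p : Ed d × Ed d => (u p.1).toReal) γ := by
    rw [← hγ1, Measure.fst] at hu
    exact hu.comp_measurable measurable_fst
  have hψ' : Integrable (fun p : Ed d × Ed d => (legendre u p.2).toReal) γ := by
    rw [← hγ2, Measure.snd] at hψ
    exact hψ.comp_measurable measurable_snd
  have hle : pairInt γ ≤ eintegral γ fun p => (u p.1).toReal + (legendre u p.2).toReal := by
    refine eintegral_mono_ae ?_
    filter_upwards [hfst, hsnd] with p hp1 hp2 using inner_le_add_legendre hubot hp1 hp2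
  refine hle.trans ?_
  have hsum : Integrable (fun p : Ed d × Ed d => (u p.1).toReal + (legendre u p.2).toReal) γ :=
    hu'.add hψ'
  rw [eintegral_eq_integral hsum, EReal.coe_le_coe_iff, integral_add hu' hψ']
  have e1 : ∫ p, (u p.1).toReal ∂γ = ∫ x, (u x).toReal ∂(expNegMeasure u) := by
    rw [← hγ1, Measure.fst, integral_map measurable_fst.aemeasurable
      hulsc.measurable.ereal_toReal.aestronglyMeasurable]
  have e2 : ∫ p, (legendre u p.2).toReal ∂γ = ∫ y, (legendre u y).toReal ∂μ := by
    rw [← hγ2, Measure.snd, integral_map measurable_snd.aemeasurable hψm.aestronglyMeasurable]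
  rw [e1, e2, hψint]
  linarith

end Fenchel

section PartialIntegration

variable {E : Type*} [NormedAddCommGroup E] [NormedSpace ℝ E] [FiniteDimensional ℝ E]
  [MeasurableSpace E] [BorelSpace E] {ν : Measure E} [ν.IsAddHaarMeasure]

/-- The lower right slope of `A` in the direction `e`, along the sequence of steps `1 / (m + 1)`. -/
def lineSlope (A : E → ℝ) (e : E) (x : E) : ℝ≥0∞ :=
  liminf (fun m : ℕ => ENNReal.ofReal (((m : ℝ) + 1) * (A (x + (1 / ((m : ℝ) + 1)) • e) - A x)))
    atTop

theorem integrable_prod_translate {φ : E → ℝ} (hφ : Integrable φ ν) (hφm : Measurable φ) (e : E)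
    (h : ℝ) : Integrable (fun p : E × ℝ => φ (p.1 - p.2 • e))
      (ν.prod (volume.restrict (Set.Ioc 0 h))) := by
  have hm : Measurable fun p : E × ℝ => φ (p.1 - p.2 • e) := hφm.comp (by fun_prop)
  rw [integrable_prod_iff' hm.aestronglyMeasurable]
  refine ⟨Eventually.of_forall fun s => hφ.comp_sub_right (s • e), ?_⟩
  simp only
  have : (fun s : ℝ => ∫ x, ‖φ (x - s • e)‖ ∂ν) = fun _ => ∫ x, ‖φ x‖ ∂ν := by
    ext s
    exact integral_sub_right_eq_self (fun x => ‖φ x‖) (s • e)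
  rw [this]
  exact integrable_const _

theorem tendsto_of_lineSlope_lt_top {F : Type*} [NormedAddCommGroup F] [NormedSpace ℝ F]
    {A : F → ℝ} {e x : F}
    (hmono : Monotone fun t : ℝ => A (x + t • e)) (hD : lineSlope A e x < ∞) :
    Tendsto (fun m : ℕ => A (x + (1 / ((m : ℝ) + 1)) • e)) atTop (𝓝 (A x)) := by
  have hle : ∀ t : ℝ, 0 ≤ t → A x ≤ A (x + t • e) := fun t ht => by simpa using hmono ht
  have hanti : Antitone fun m : ℕ => A (x + (1 / ((m : ℝ) + 1)) • e) := fun m n hmn =>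
    hmono (Nat.one_div_le_one_div hmn)
  refine tendsto_order.2 ⟨fun a ha => Eventually.of_forall fun m =>
    ha.trans_le (hle _ (by positivity)), fun a ha => ?_⟩
  by_contra hcon
  have hall : ∀ m : ℕ, a ≤ A (x + (1 / ((m : ℝ) + 1)) • e) := fun m => by
    by_contra hm
    exact hcon ((eventually_ge_atTop m).mono fun n hn => (hanti hn).trans_lt (not_le.1 hm))
  have htop : Tendsto (fun m : ℕ => ENNReal.ofReal (((m : ℝ) + 1) * (a - A x))) atTop (𝓝 ∞) :=
    ENNReal.tendsto_ofReal_atTop.comp ((tendsto_atTop_add_const_right _ _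
      tendsto_natCast_atTop_atTop).atTop_mul_const (sub_pos.2 ha))
  have : ∞ ≤ lineSlope A e x := by
    rw [← htop.liminf_eq]
    refine liminf_le_liminf (Eventually.of_forall fun m => ENNReal.ofReal_le_ofReal ?_)
    exact mul_le_mul_of_nonneg_left (sub_le_sub_right (hall m) _) (by positivity)
  exact absurd hD (not_lt.2 this)

theorem integral_mul_translate_sub_le {f φ A : E → ℝ} {e : E} {R h : ℝ} (hh : 0 < h)
    (hf : Integrable f ν) (hφ : Integrable φ ν) (hφm : Measurable φ)
    (hftc : ∀ᵐ x ∂ν, IntervalIntegrable (fun s => φ (x - s • e)) volume 0 h →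
      ∫ s in (0)..h, φ (x - s • e) = f (x - h • e) - f x)
    (hA : Measurable A) (hAR : ∀ x, |A x| ≤ R) (hmono : ∀ x, Monotone fun t : ℝ => A (x + t • e)) :
    ∫ x, (A (x + h • e) - A x) * f x ∂ν ≤
      h * (∫ x, A x * φ x ∂ν + ∫ x, (A (x + h • e) - A x) * |φ x| ∂ν) := by
  have hbm : ∀ {ψ : E → ℝ}, Integrable ψ ν → ∀ {B : E → ℝ}, Measurable B → (∀ x, |B x| ≤ R) →
      Integrable (fun x => B x * ψ x) ν := fun hψ B hB hBR =>
    hψ.bdd_mul hB.aestronglyMeasurable (Eventually.of_forall hBR)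
  have hAt : ∀ s : ℝ, Measurable fun x => A (x + s • e) := fun s => hA.comp (by fun_prop)
  have h1 : ∫ x, (A (x + h • e) - A x) * f x ∂ν = ∫ x, A x * (f (x - h • e) - f x) ∂ν := by
    have e1 : ∫ x, A (x + h • e) * f x ∂ν = ∫ x, A x * f (x - h • e) ∂ν := by
      rw [← integral_add_right_eq_self (fun x => A x * f (x - h • e)) (h • e)]
      simp
    simp only [sub_mul, mul_sub]
    rw [integral_sub (hbm hf (hAt h) fun x => hAR _) (hbm hf hA hAR),
      integral_sub (hbm (hf.comp_sub_right _) hA hAR) (hbm hf hA hAR), e1]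
  have hprod := integrable_prod_translate hφ hφm e h
  have hprodA : Integrable (fun p : E × ℝ => A p.1 * φ (p.1 - p.2 • e))
      (ν.prod (volume.restrict (Set.Ioc 0 h))) :=
    hprod.bdd_mul (hA.comp measurable_fst).aestronglyMeasurable
      (Eventually.of_forall fun p => hAR p.1)
  have h2 : ∫ x, A x * (f (x - h • e) - f x) ∂ν =
      ∫ x, (∫ s in Set.Ioc 0 h, A x * φ (x - s • e)) ∂ν := by
    refine integral_congr_ae ?_
    filter_upwards [hftc, hprod.prod_right_ae] with x hx hix
    rw [integral_const_mul, ← hx ((intervalIntegrable_iff_integrableOn_Ioc_of_le hh.le).2 hix),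
      intervalIntegral.integral_of_le hh.le]
  have h3 : ∫ x, (∫ s in Set.Ioc 0 h, A x * φ (x - s • e)) ∂ν =
      ∫ s in Set.Ioc 0 h, (∫ x, A (x + s • e) * φ x ∂ν) := by
    rw [integral_integral_swap hprodA]
    refine integral_congr_ae (Eventually.of_forall fun s => ?_)
    simp only
    rw [← integral_add_right_eq_self (fun x => A x * φ (x - s • e)) (s • e)]
    simp
  have hint2 : Integrable (fun x => (A (x + h • e) - A x) * |φ x|) ν := by
    simp only [sub_mul]
    exact (hbm hφ.abs (hAt h) fun x => hAR _).sub (hbm hφ.abs hA hAR)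
  have h4 : ∀ s ∈ Set.Ioc 0 h, ∫ x, A (x + s • e) * φ x ∂ν ≤
      ∫ x, A x * φ x ∂ν + ∫ x, (A (x + h • e) - A x) * |φ x| ∂ν := fun s hs => by
    rw [← integral_add (hbm hφ hA hAR) hint2]
    refine integral_mono (hbm hφ (hAt s) fun x => hAR _) ((hbm hφ hA hAR).add hint2) fun x => ?_
    have m1 : A x ≤ A (x + s • e) := by simpa using hmono x hs.1.le
    have m2 : A (x + s • e) ≤ A (x + h • e) := hmono x hs.2
    have m3 : (A (x + s • e) - A x) * φ x ≤ (A (x + s • e) - A x) * |φ x| :=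
      mul_le_mul_of_nonneg_left (le_abs_self _) (sub_nonneg.2 m1)
    have m4 : (A (x + s • e) - A x) * |φ x| ≤ (A (x + h • e) - A x) * |φ x| :=
      mul_le_mul_of_nonneg_right (sub_le_sub_right m2 _) (abs_nonneg _)
    linarith
  rw [h1, h2, h3]
  have hi : IntegrableOn (fun s => ∫ x, A (x + s • e) * φ x ∂ν) (Set.Ioc 0 h) := by
    refine (hprodA.integral_prod_right).congr (Eventually.of_forall fun s => ?_)
    simp only
    rw [← integral_add_right_eq_self (fun x => A x * φ (x - s • e)) (s • e)]
    simp
  refine (setIntegral_mono_on hi (integrableOn_const (by simp)) measurableSet_Ioc h4).trans_eq ?_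
  simp [hh.le]

/-- Integration by parts inequality against a bounded function that is nondecreasing in the
direction `e`. -/
theorem lintegral_lineSlope_le {f φ A : E → ℝ} {e : E} {R : ℝ}
    (hf : Integrable f ν) (hfm : Measurable f) (hf0 : ∀ x, 0 ≤ f x)
    (hφ : Integrable φ ν) (hφm : Measurable φ) (hfφ : ∀ x, f x = 0 → φ x = 0)
    (hftc : ∀ h > 0, ∀ᵐ x ∂ν, IntervalIntegrable (fun s => φ (x - s • e)) volume 0 h →
      ∫ s in (0)..h, φ (x - s • e) = f (x - h • e) - f x)
    (hA : Measurable A) (hAR : ∀ x, |A x| ≤ R) (hmono : ∀ x, Monotone fun t : ℝ => A (x + t • e))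
    (hD : ∀ᵐ x ∂ν, f x ≠ 0 → lineSlope A e x < ∞) :
    ∫⁻ x, lineSlope A e x * ENNReal.ofReal (f x) ∂ν ≤ ENNReal.ofReal (∫ x, A x * φ x ∂ν) := by
  set h : ℕ → ℝ := fun m => 1 / ((m : ℝ) + 1) with hh
  have hh0 : ∀ m, 0 < h m := fun m => by positivity
  have hAt : ∀ s : ℝ, Measurable fun x => A (x + s • e) := fun s => hA.comp (by fun_prop)
  have hnn : ∀ m x, 0 ≤ A (x + h m • e) - A x := fun m x =>
    sub_nonneg.2 (by simpa using hmono x (hh0 m).le)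
  have hlim : Tendsto (fun m => ∫ x, (A (x + h m • e) - A x) * |φ x| ∂ν) atTop (𝓝 0) := by
    have : (0 : ℝ) = ∫ _ : E, (0 : ℝ) ∂ν := by simp
    rw [this]
    refine tendsto_integral_of_dominated_convergence (fun x => 2 * R * |φ x|)
      (fun m => (((hAt _).sub hA).mul hφm.abs).aestronglyMeasurable)
      (hφ.abs.const_mul _) (fun m => Eventually.of_forall fun x => ?_) ?_
    · rw [norm_mul, Real.norm_eq_abs, Real.norm_eq_abs, abs_abs]
      refine mul_le_mul_of_nonneg_right ?_ (abs_nonneg _)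
      have := abs_sub (A (x + h m • e)) (A x)
      linarith [hAR x, hAR (x + h m • e)]
    · filter_upwards [hD] with x hx
      by_cases hfx : f x = 0
      · simp [hfφ x hfx]
      · have := ((tendsto_of_lineSlope_lt_top (hmono x) (hx hfx)).sub_const (A x)).mul_const |φ x|
        rwa [sub_self, zero_mul] at this
  have hbound : ∀ m : ℕ, ∫⁻ x, ENNReal.ofReal (((m : ℝ) + 1) * (A (x + h m • e) - A x)) *
      ENNReal.ofReal (f x) ∂ν ≤
      ENNReal.ofReal (∫ x, A x * φ x ∂ν + ∫ x, (A (x + h m • e) - A x) * |φ x| ∂ν) := fun m => by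
    have hint : Integrable (fun x => (A (x + h m • e) - A x) * f x) ν :=
      hf.bdd_mul ((hAt _).sub hA).aestronglyMeasurable (c := 2 * R)
        (Eventually.of_forall fun x => by
          have := abs_sub (A (x + h m • e)) (A x)
          rw [Real.norm_eq_abs]
          linarith [hAR x, hAR (x + h m • e)])
    have e1 : ∀ x, ENNReal.ofReal (((m : ℝ) + 1) * (A (x + h m • e) - A x)) *
        ENNReal.ofReal (f x) = ENNReal.ofReal (((m : ℝ) + 1) * ((A (x + h m • e) - A x) * f x)) :=
      fun x => by
        rw [← ENNReal.ofReal_mul (mul_nonneg (by positivity) (hnn m x)), mul_assoc]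
    simp only [e1]
    rw [← ofReal_integral_eq_lintegral_ofReal (hint.const_mul _) (Eventually.of_forall fun x =>
      mul_nonneg (by positivity) (mul_nonneg (hnn m x) (hf0 x)))]
    refine ENNReal.ofReal_le_ofReal ?_
    rw [integral_const_mul]
    have hk := integral_mul_translate_sub_le (hh0 m) hf hφ hφm (hftc _ (hh0 m)) hA hAR hmono
    calc _ ≤ ((m : ℝ) + 1) * (h m * (∫ x, A x * φ x ∂ν +
          ∫ x, (A (x + h m • e) - A x) * |φ x| ∂ν)) :=
          mul_le_mul_of_nonneg_left hk (by positivity)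
      _ = _ := by
          rw [← mul_assoc, hh]
          field_simp
  calc ∫⁻ x, lineSlope A e x * ENNReal.ofReal (f x) ∂ν
      ≤ ∫⁻ x, liminf (fun m : ℕ => ENNReal.ofReal (((m : ℝ) + 1) * (A (x + h m • e) - A x)) *
        ENNReal.ofReal (f x)) atTop ∂ν := by
        refine lintegral_mono fun x => ?_
        rw [lineSlope, mul_comm, ← ENNReal.liminf_mul_const_of_ne_top ENNReal.ofReal_ne_top]
    _ ≤ liminf (fun m : ℕ => ∫⁻ x, ENNReal.ofReal (((m : ℝ) + 1) * (A (x + h m • e) - A x)) *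
        ENNReal.ofReal (f x) ∂ν) atTop := lintegral_liminf_le fun m =>
          (((hAt _).sub hA).const_mul _).ennreal_ofReal.mul hfm.ennreal_ofReal
    _ ≤ liminf (fun m : ℕ => ENNReal.ofReal (∫ x, A x * φ x ∂ν +
        ∫ x, (A (x + h m • e) - A x) * |φ x| ∂ν)) atTop :=
          liminf_le_liminf (Eventually.of_forall hbound)
    _ = _ := by
        have := (ENNReal.continuous_ofReal.tendsto _).comp (hlim.const_add (∫ x, A x * φ x ∂ν))
        rw [add_zero] at this
        exact this.liminf_eq

end PartialIntegration

section LineFTC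

variable {J : Set ℝ} {w g p : ℝ → ℝ} {a b : ℝ}

theorem integral_eq_sub_of_Ioo_subset (hw : ConvexOn ℝ J w)
    (hgJ : ∀ s ∈ J, g s = Real.exp (-(w s))) (hgc : Continuous g)
    (hp : ∀ᵐ s, s ∈ J → HasDerivAt g (p s) s) (hab : a ≤ b)
    (hint : IntervalIntegrable p volume a b) (hJ : Set.Ioo a b ⊆ J) :
    ∫ s in a..b, p s = g b - g a := by
  have hae : p =ᵐ[volume.restrict (Set.uIoc a b)] fun s => derivWithin g (Set.Ioi s) s := by
    rw [Set.uIoc_of_le hab, ← restrict_Ioo_eq_restrict_Ioc]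
    filter_upwards [ae_restrict_of_ae hp, ae_restrict_mem measurableSet_Ioo] with s hs hsI
    exact ((hs (hJ hsI)).hasDerivWithinAt.derivWithin (uniqueDiffWithinAt_Ioi s)).symm
  rw [intervalIntegral.integral_congr_ae_restrict hae]
  refine intervalIntegral.integral_eq_sub_of_hasDeriv_right hgc.continuousOn (fun s hs => ?_)
    (hint.congr_ae hae)
  rw [min_eq_left hab, max_eq_right hab] at hs
  have hsJ : s ∈ interior J := mem_interior.2 ⟨_, hJ, isOpen_Ioo, hs⟩
  have h1 := (hw.hasDerivWithinAt_rightDeriv_of_mem_interior hsJ).fun_neg.exp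
  have h2 : DifferentiableWithinAt ℝ g (Set.Ioi s) s := by
    refine (h1.differentiableWithinAt).congr_of_eventuallyEq ?_ (hgJ s (interior_subset hsJ))
    filter_upwards [mem_nhdsWithin_of_mem_nhds (mem_interior_iff_mem_nhds.1 hsJ)] with t ht
      using hgJ t ht
  exact h2.hasDerivWithinAt

theorem integral_eq_sub_of_Ioo_disjoint (hg0 : ∀ s ∉ J, g s = 0) (hgc : Continuous g)
    (hp0 : ∀ s ∉ J, p s = 0) (hab : a ≤ b) (hJ : ∀ s ∈ Set.Ioo a b, s ∉ J) :
    ∫ s in a..b, p s = g b - g a := by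
  have h1 : ∫ s in a..b, p s = 0 := by
    rw [intervalIntegral.integral_of_le hab, integral_Ioc_eq_integral_Ioo]
    exact setIntegral_eq_zero_of_forall_eq_zero fun s hs => hp0 s (hJ s hs)
  rcases hab.eq_or_lt with rfl | hlt
  · simp
  have h2 : Set.EqOn g (fun _ => 0) (Set.Icc a b) := by
    rw [← closure_Ioo hlt.ne]
    exact Set.EqOn.closure (fun s hs => hg0 s (hJ s hs)) hgc continuous_const
  rw [h1, h2 (Set.left_mem_Icc.2 hab), h2 (Set.right_mem_Icc.2 hab), sub_zero]

/-- The fundamental theorem of calculus for `e^{-w}` with `w` convex on a subset of the line,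
provided that the extension by zero is continuous. -/
theorem integral_eq_sub_of_convexOn (hw : ConvexOn ℝ J w)
    (hgJ : ∀ s ∈ J, g s = Real.exp (-(w s))) (hg0 : ∀ s ∉ J, g s = 0) (hgc : Continuous g)
    (hp : ∀ᵐ s, s ∈ J → HasDerivAt g (p s) s) (hp0 : ∀ s ∉ J, p s = 0) (hab : a ≤ b)
    (hint : IntervalIntegrable p volume a b) :
    ∫ s in a..b, p s = g b - g a := by
  by_cases hK : (J ∩ Set.Ioo a b).Nonempty
  swap
  · exact integral_eq_sub_of_Ioo_disjoint hg0 hgc hp0 hab fun s hs hsJ => hK ⟨s, hsJ, hs⟩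
  set K := J ∩ Set.Ioo a b
  have hbb : BddBelow K := ⟨a, fun s hs => hs.2.1.le⟩
  have hba : BddAbove K := ⟨b, fun s hs => hs.2.2.le⟩
  have haα : a ≤ sInf K := le_csInf hK fun s hs => hs.2.1.le
  have hβb : sSup K ≤ b := csSup_le hK fun s hs => hs.2.2.le
  have hαβ : sInf K ≤ sSup K := csInf_le_csSup hK hbb hba
  have hi1 : IntervalIntegrable p volume a (sInf K) := hint.mono_set <| by
    rw [Set.uIcc_of_le hab, Set.uIcc_of_le haα]
    exact Set.Icc_subset_Icc le_rfl (hαβ.trans hβb)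
  have hi2 : IntervalIntegrable p volume (sInf K) (sSup K) := hint.mono_set <| by
    rw [Set.uIcc_of_le hab, Set.uIcc_of_le hαβ]
    exact Set.Icc_subset_Icc haα hβb
  have hi3 : IntervalIntegrable p volume (sSup K) b := hint.mono_set <| by
    rw [Set.uIcc_of_le hab, Set.uIcc_of_le hβb]
    exact Set.Icc_subset_Icc (haα.trans hαβ) le_rfl
  have e1 := integral_eq_sub_of_Ioo_disjoint (a := a) (b := sInf K) hg0 hgc hp0 haα
    fun s hs hsJ => not_le_of_gt hs.2
      (csInf_le hbb ⟨hsJ, hs.1, hs.2.trans_le (hαβ.trans hβb)⟩)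
  have e3 := integral_eq_sub_of_Ioo_disjoint (a := sSup K) (b := b) hg0 hgc hp0 hβb
    fun s hs hsJ => not_le_of_gt hs.1
      (le_csSup hba ⟨hsJ, (haα.trans hαβ).trans_lt hs.1, hs.2⟩)
  have e2 := integral_eq_sub_of_Ioo_subset hw hgJ hgc hp hαβ hi2 fun s hs => by
    obtain ⟨s₁, h1, h1'⟩ := exists_lt_of_csInf_lt hK hs.1
    obtain ⟨s₂, h2, h2'⟩ := exists_lt_of_lt_csSup hK hs.2
    exact hw.1.ordConnected.out h1.1 h2.1 ⟨h1'.le, h2'.le⟩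
  rw [← intervalIntegral.integral_add_adjacent_intervals (hi1.trans hi2) hi3,
    ← intervalIntegral.integral_add_adjacent_intervals hi1 hi2, e1, e2, e3]
  ring

end LineFTC

section EssentialContinuity

variable {d : ℕ} {u : Ed d → EReal}

theorem continuousAt_expNegDensity (hubot : ∀ x, u x ≠ ⊥) (huconv : EConvexOn u)
    (hulsc : LowerSemicontinuous u) {z : Ed d} (hz : ¬ (z ∈ frontier (effDom u) ∧ u z < ⊤)) :
    ContinuousAt (expNegDensity u) z := by
  by_cases hzd : z ∈ effDom u
  · have hzi : z ∈ interior (effDom u) := by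
      by_contra h
      exact hz ⟨⟨subset_closure hzd, h⟩, hzd⟩
    have hc : ContinuousAt (fun x => (u x).toReal) z :=
      ((convexOn_toReal hubot huconv).locallyLipschitzOn_interior.continuousOn).continuousAt
        (isOpen_interior.mem_nhds hzi)
    refine (hc.fun_neg.rexp).congr ?_
    filter_upwards [isOpen_interior.mem_nhds hzi] with x hx
    exact (expNegDensity_of_mem (interior_subset hx)).symm
  · rw [ContinuousAt, expNegDensity_of_notMem hzd, Metric.tendsto_nhds]
    intro ε hε
    have hlt : ((-Real.log ε : ℝ) : EReal) < u z := by
      rw [show u z = ⊤ from not_lt_top_iff.1 hzd]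
      exact EReal.coe_lt_top _
    filter_upwards [hulsc z _ hlt] with x hx
    rw [Real.dist_eq, sub_zero, abs_of_nonneg (expNegDensity_nonneg x)]
    by_cases hxd : x ∈ effDom u
    · rw [expNegDensity_of_mem hxd, ← Real.lt_log_iff_exp_lt hε]
      rw [← coe_toReal_of_mem_effDom hubot hxd] at hx
      have := EReal.coe_lt_coe_iff.1 hx
      linarith
    · rwa [expNegDensity_of_notMem hxd]

/-- Almost every line in a coordinate direction avoids a set of zero `(d-1)`-dimensional
Hausdorff measure. -/
theorem ae_line_notMem_of_hausdorffMeasure_eq_zero {B : Set (Ed d)}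
    (hB : μH[(d : ℝ) - 1] B = 0) (k : Fin d) :
    ∀ᵐ x : Ed d, ∀ s : ℝ, x - s • EuclideanSpace.single k (1 : ℝ) ∉ B := by
  obtain _ | n := d
  · exact k.elim0
  set q : Ed (n + 1) → (Fin n → ℝ) := fun x j => x (k.succAbove j) with hq
  have hL : LipschitzWith 1 q := by
    refine LipschitzWith.of_dist_le_mul fun x y => ?_
    rw [NNReal.coe_one, one_mul]
    refine (dist_pi_le_iff dist_nonneg).2 fun j => ?_
    rw [EuclideanSpace.dist_eq, ← Real.sqrt_sq (dist_nonneg (x := q x j))]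
    exact Real.sqrt_le_sqrt (Finset.single_le_sum (f := fun i => dist (x i) (y i) ^ 2)
      (fun i _ => sq_nonneg _) (Finset.mem_univ (k.succAbove j)))
  have h0 : volume (q '' B) = 0 := by
    rw [← hausdorffMeasure_pi_real, Fintype.card_fin]
    have h := hL.hausdorffMeasure_image_le (d := (n : ℝ)) (Nat.cast_nonneg n) B
    have hd : ((n + 1 : ℕ) : ℝ) - 1 = n := by push_cast; ring
    rw [hd] at hB
    rw [hB, mul_zero] at h
    exact le_antisymm h zero_le
  have hqmp : Measure.QuasiMeasurePreserving q volume volume := by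
    have h1 := (PiLp.volume_preserving_ofLp (Fin (n + 1))).quasiMeasurePreserving
    have h2 := (volume_preserving_piFinSuccAbove (fun _ : Fin (n + 1) => ℝ) k).quasiMeasurePreserving
    have h3 : Measure.QuasiMeasurePreserving (Prod.snd : ℝ × (Fin n → ℝ) → Fin n → ℝ) volume volume :=
      Measure.quasiMeasurePreserving_snd
    exact (h3.comp h2).comp h1
  filter_upwards [measure_eq_zero_iff_ae_notMem.1 (hqmp.preimage_null h0)] with x hx s hs
  refine hx ⟨_, hs, ?_⟩
  funext j
  simp [hq]

theorem ae_ae_line {P : Ed d → Prop} (hP : ∀ᵐ x, P x) (e : Ed d) :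
    ∀ᵐ x : Ed d, ∀ᵐ s : ℝ, P (x - s • e) := by
  have hqmp : Measure.QuasiMeasurePreserving (fun p : Ed d × ℝ => p.1 - p.2 • e)
      (volume.prod volume) volume := by
    refine ⟨by fun_prop, ?_⟩
    refine Measure.AbsolutelyContinuous.mk fun s hs h0 => ?_
    rw [Measure.map_apply (by fun_prop) hs]
    rw [Measure.prod_apply_symm (hs.preimage (by fun_prop)), lintegral_eq_zero_of_ae_eq_zero]
    refine Eventually.of_forall fun t => ?_
    have := (measurePreserving_sub_right (volume : Measure (Ed d)) (t • e)).measure_preimage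
      hs.nullMeasurableSet
    exact this.trans h0
  exact Measure.ae_ae_of_ae_prod (hqmp.ae hP)

theorem integral_line_expNegDensity (hubot : ∀ x, u x ≠ ⊥) (huconv : EConvexOn u)
    (hulsc : LowerSemicontinuous u) (hess : EssentiallyContinuous u) (k : Fin d) :
    ∀ᵐ x : Ed d, ∀ h : ℝ, 0 ≤ h →
      IntervalIntegrable (fun s => (fun y => expNegDensity u y *
        ⟪realGradient u y, EuclideanSpace.single k (1 : ℝ)⟫)
        (x - s • EuclideanSpace.single k (1 : ℝ))) volume 0 h →
      ∫ s in (0 : ℝ)..h, (fun y => expNegDensity u y *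
        ⟪realGradient u y, EuclideanSpace.single k (1 : ℝ)⟫)
        (x - s • EuclideanSpace.single k (1 : ℝ))
        = expNegDensity u (x - h • EuclideanSpace.single k (1 : ℝ)) - expNegDensity u x := by
  set e : Ed d := EuclideanSpace.single k (1 : ℝ)
  filter_upwards [ae_line_notMem_of_hausdorffMeasure_eq_zero hess k,
    ae_ae_line (ae_mem_interior_differentiableAt hubot huconv) e] with x hxB hx h hh hint
  have hline : Continuous fun s : ℝ => x - s • e := by fun_prop
  have hd : ∀ s : ℝ, HasDerivAt (fun s : ℝ => x - s • e) (-e) s := fun s => by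
    simpa using ((hasDerivAt_id s).smul_const e).const_sub x
  have hconv : ConvexOn ℝ ((fun s : ℝ => x - s • e) ⁻¹' effDom u)
      fun s => (u (x - s • e)).toReal := by
    have := (convexOn_toReal hubot huconv).comp_affineMap (AffineMap.lineMap x (x - e))
    have he : ∀ s : ℝ, (AffineMap.lineMap x (x - e) : ℝ →ᵃ[ℝ] Ed d) s = x - s • e := fun s => by
      simp [AffineMap.lineMap_apply, sub_eq_neg_add]
    simpa only [Function.comp_def, Set.preimage, he] using this
  have := integral_eq_sub_of_convexOn hconv (g := fun s => expNegDensity u (x - s • e))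
    (fun s hs => expNegDensity_of_mem hs) (fun s hs => expNegDensity_of_notMem hs)
    (continuous_iff_continuousAt.2 fun s =>
      (continuousAt_expNegDensity hubot huconv hulsc (hxB s)).comp
        (f := fun s : ℝ => x - s • e) hline.continuousAt)
    (p := fun s => expNegDensity u (x - s • e) * ⟪realGradient u (x - s • e), e⟫) ?_
    (fun s hs => by rw [expNegDensity_of_notMem hs, zero_mul]) hh hint
  · simpa using this
  filter_upwards [hx] with s hs hsJ
  obtain ⟨hi, hdiff⟩ := hs hsJ
  have h1 := (hdiff.hasFDerivAt.comp_hasDerivAt s (hd s)).fun_neg.exp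
  refine (h1.congr_of_eventuallyEq ?_).congr_deriv ?_
  · filter_upwards [hline.continuousAt.preimage_mem_nhds (mem_interior_iff_mem_nhds.1 hi)] with t ht
    exact expNegDensity_of_mem ht
  · rw [map_neg, neg_neg, fderiv_toReal_apply, expNegDensity_of_mem hsJ]
    rfl

end EssentialContinuity

section KnotheMap

variable {d : ℕ} {u : Ed d → EReal}

theorem map_ofLp_withDensity {f : Ed d → ℝ≥0∞} (hf : Measurable f) :
    (volume.withDensity f).map (WithLp.ofLp : Ed d → Fin d → ℝ)
      = volume.withDensity fun y => f (WithLp.toLp 2 y) := by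
  have hmp := PiLp.volume_preserving_ofLp (Fin d)
  refine Measure.ext fun s hs => ?_
  rw [Measure.map_apply hmp.measurable hs, withDensity_apply _ (hmp.measurable hs),
    withDensity_apply _ hs]
  exact hmp.setLIntegral_comp_preimage hs (f := fun y => f (WithLp.toLp 2 y)) (hf.comp (by fun_prop))

theorem map_toLp_withDensity {f : Ed d → ℝ≥0∞} (hf : Measurable f) :
    (volume.withDensity fun y => f (WithLp.toLp 2 y)).map
      (WithLp.toLp 2 : (Fin d → ℝ) → Ed d) = volume.withDensity f := by
  rw [← map_ofLp_withDensity hf, Measure.map_map (by fun_prop) (by fun_prop)]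
  exact Measure.map_id

theorem abs_mul_log_le {t : ℝ} (ht : 0 ≤ t) : |t * Real.log t| ≤ 1 + t ^ 2 := by
  rcases ht.eq_or_lt with rfl | ht
  · simp
  have h1 := Real.log_le_sub_one_of_pos ht
  have h2 := Real.one_sub_inv_le_log_of_pos ht
  have h3 : t * (1 - t⁻¹) = t - 1 := by field_simp
  rw [abs_le]
  constructor
  · nlinarith [mul_le_mul_of_nonneg_left h2 ht.le, sq_nonneg t]
  · nlinarith [mul_le_mul_of_nonneg_left h1 ht.le]

/-- The Knothe map between densities on Euclidean space. -/
theorem exists_knothe_map_euclidean {R : ℝ} (hR : 0 ≤ R) {f g : Ed d → ℝ≥0∞}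
    (hf : Measurable f) (hg : Measurable g) (hf1 : ∫⁻ x, f x = 1) (hg1 : ∫⁻ x, g x = 1)
    (hgR : ∀ y, ∀ k, y k ∉ Set.Icc (-R) R → g y = 0) :
    ∃ S : Ed d → Ed d, Measurable S ∧ (∀ x k, |S x k| ≤ R) ∧
      (∀ x k, Monotone fun t : ℝ => S (x + t • EuclideanSpace.single k (1 : ℝ)) k) ∧
      (volume.withDensity f).map S = volume.withDensity g ∧
      ∀ᵐ x ∂(volume.withDensity f),
        (∀ k, lineSlope (fun x => S x k) (EuclideanSpace.single k (1 : ℝ)) x < ∞) ∧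
        f x = g (S x) * ∏ k, lineSlope (fun x => S x k) (EuclideanSpace.single k (1 : ℝ)) x := by
  have hmp := PiLp.volume_preserving_toLp (Fin d)
  obtain ⟨S, hS, hSR, hSm, hSmap, hSae⟩ := exists_knothe_map hR d
    (f := fun y => f (WithLp.toLp 2 y)) (g := fun y => g (WithLp.toLp 2 y))
    (hf.comp (by fun_prop)) (hg.comp (by fun_prop))
    (by rw [hmp.lintegral_comp hf, hf1]) (by rw [hmp.lintegral_comp hg, hg1])
    (fun y k hy => hgR _ k hy)
  have hupd : ∀ (x : Ed d) (k : Fin d) (t : ℝ),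
      (WithLp.ofLp (x + t • EuclideanSpace.single k (1 : ℝ)) : Fin d → ℝ)
        = Function.update (WithLp.ofLp x) k (x k + t) := fun x k t => by
    funext j
    rcases eq_or_ne j k with rfl | h <;> simp_all
  refine ⟨fun x => WithLp.toLp 2 (S (WithLp.ofLp x)), by fun_prop, fun x k => hSR _ k,
    fun x k => ?_, ?_, ?_⟩
  · simp only [hupd]
    exact (hSm (WithLp.ofLp x) k).comp fun a b hab => by simpa using hab
  · have : (fun x : Ed d => (WithLp.toLp 2 (S (WithLp.ofLp x)) : Ed d))
        = (WithLp.toLp 2 : (Fin d → ℝ) → Ed d) ∘ S ∘ WithLp.ofLp := rfl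
    rw [this, ← Measure.map_map (by fun_prop) (by fun_prop),
      ← Measure.map_map (by fun_prop) (by fun_prop), map_ofLp_withDensity hf, hSmap,
      map_toLp_withDensity hg]
  · rw [← map_ofLp_withDensity hf] at hSae
    have hsl : ∀ x k, lineSlope (fun x => S (WithLp.ofLp x) k) (EuclideanSpace.single k (1 : ℝ)) x
        = diagSlope S k (WithLp.ofLp x) := fun x k => by
      simp only [lineSlope, diagSlope, hupd]
    filter_upwards [ae_of_ae_map (by fun_prop) hSae] with x hx
    simpa only [hsl] using hx

theorem integral_mul_log_add_integral_inner_ge_of_bounded (hubot : ∀ x, u x ≠ ⊥)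
    (huconv : EConvexOn u) (hulsc : LowerSemicontinuous u) (hess : EssentiallyContinuous u)
    (hnorm : ∫ x, expNegDensity u x = 1)
    (hgrad : Integrable (realGradient u) (expNegMeasure u))
    {g : Ed d → ℝ} (hg : Measurable g) (hg0 : ∀ x, 0 ≤ g x) {R M : ℝ} (hR : 0 ≤ R)
    (hgM : ∀ x, g x ≤ M) (hgR : ∀ x, g x ≠ 0 → ‖x‖ ≤ R)
    (hg1 : ∫⁻ x, ENNReal.ofReal (g x) = 1) :
    ∃ S : Ed d → Ed d, Measurable S ∧
      Integrable (fun x => ⟪S x, realGradient u x⟫) (expNegMeasure u) ∧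
      (expNegMeasure u).map S = volume.withDensity (fun x => ENNReal.ofReal (g x)) ∧
      Integrable (fun x => g x * Real.log (g x)) ∧
      d - ∫ x, (u x).toReal ∂(expNegMeasure u) ≤
        (∫ x, g x * Real.log (g x)) + ∫ x, ⟪S x, realGradient u x⟫ ∂(expNegMeasure u) := by
  have := isProbabilityMeasure_expNegMeasure hnorm
  obtain ⟨S, hS, hSR, hSm, hSmap, hSae⟩ := exists_knothe_map_euclidean hR
    (measurable_expNegDensity hulsc).ennreal_ofReal hg.ennreal_ofReal
    (lintegral_expNegDensity hnorm) hg1 fun y k hy => by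
      by_contra hne
      have h0 : g y ≠ 0 := fun h => hne (by rw [h, ENNReal.ofReal_zero])
      exact hy (abs_le.1 ((PiLp.norm_apply_le y k).trans (hgR y h0)))
  change (expNegMeasure u).map S = _ at hSmap
  change ∀ᵐ x ∂(expNegMeasure u), _ at hSae
  have hgradk : ∀ k, Integrable (fun x => realGradient u x k) (expNegMeasure u) := fun k =>
    (EuclideanSpace.proj (𝕜 := ℝ) k).integrable_comp hgrad
  have hSk : ∀ k, Measurable fun x => S x k := fun k => by fun_prop
  have hSgk : ∀ k, Integrable (fun x => S x k * realGradient u x k) (expNegMeasure u) := fun k =>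
    (hgradk k).bdd_mul (hSk k).aestronglyMeasurable (Eventually.of_forall fun x => hSR x k)
  have hinner : ∀ x, ⟪S x, realGradient u x⟫ = ∑ k, S x k * realGradient u x k := fun x => by
    simp [PiLp.inner_apply, mul_comm]
  have hSg : Integrable (fun x => ⟪S x, realGradient u x⟫) (expNegMeasure u) := by
    simp only [hinner]
    exact integrable_finsetSum _ fun k _ => hSgk k
  have hglog : Integrable (fun x => g x * Real.log (g x)) := by
    have hball : IntegrableOn (fun x => g x * Real.log (g x)) (Metric.closedBall 0 R) := by
      refine Measure.integrableOn_of_bounded (M := 1 + M ^ 2) measure_closedBall_lt_top.ne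
        (hg.mul hg.log).aestronglyMeasurable (Eventually.of_forall fun x => ?_)
      exact (abs_mul_log_le (hg0 x)).trans (by gcongr; exacts [hg0 x, hgM x])
    refine (integrableOn_iff_integrable_of_support_subset fun x hx => ?_).1 hball
    rw [mem_closedBall_zero_iff]
    exact hgR x fun h => hx (by simp [h])
  refine ⟨S, hS, hSg, hSmap, hglog, ?_⟩
  set D : Fin d → Ed d → ℝ≥0∞ := fun k => lineSlope (fun x => S x k) (EuclideanSpace.single k (1 : ℝ))
    with hDdef
  have hDm : ∀ k, Measurable (D k) := fun k => by
    simp only [hDdef]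
    unfold lineSlope
    refine Measurable.liminf fun m => ENNReal.measurable_ofReal.comp (Measurable.const_mul ?_ _)
    exact ((hSk k).comp (by fun_prop)).sub (hSk k)
  have hSae' := (ae_expNegMeasure_iff hulsc).1 hSae
  have hDle : ∀ k, ∫⁻ x, D k x ∂(expNegMeasure u)
      ≤ ENNReal.ofReal (∫ x, S x k * realGradient u x k ∂(expNegMeasure u)) := fun k => by
    have he : ∀ x, ⟪realGradient u x, EuclideanSpace.single k (1 : ℝ)⟫ = realGradient u x k :=
      fun x => by simp [EuclideanSpace.inner_single_right]
    have hφ : Integrable (fun x => expNegDensity u x *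
        ⟪realGradient u x, EuclideanSpace.single k (1 : ℝ)⟫) := by
      simpa only [smul_eq_mul, he] using (integrable_expNegMeasure_iff hulsc).1 (hgradk k)
    have h := lintegral_lineSlope_le (ν := (volume : Measure (Ed d))) (integrable_expNegDensity hnorm)
      (measurable_expNegDensity hulsc) expNegDensity_nonneg hφ
      ((measurable_expNegDensity hulsc).mul (measurable_realGradient.inner measurable_const))
      (fun x hx => by rw [hx, zero_mul])
      (fun h hh => by
        filter_upwards [integral_line_expNegDensity hubot huconv hulsc hess k] with x hx hint
          using hx h hh.le hint)
      (hSk k) (fun x => hSR x k) (fun x => hSm x k)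
      (by
        filter_upwards [hSae'] with x hx h0
        exact (hx (expNegDensity_pos_iff.1 ((expNegDensity_nonneg x).lt_of_ne' h0))).1 k)
    have e1 : ∫⁻ x, D k x ∂(expNegMeasure u) = ∫⁻ x, D k x * ENNReal.ofReal (expNegDensity u x) := by
      rw [expNegMeasure, lintegral_withDensity_eq_lintegral_mul _
        (measurable_expNegDensity hulsc).ennreal_ofReal (hDm k)]
      exact lintegral_congr fun x => mul_comm _ _
    rw [e1, integral_expNegMeasure hulsc]
    refine h.trans_eq ?_
    congr 1
    refine integral_congr_ae (Eventually.of_forall fun x => ?_)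
    simp only [he, smul_eq_mul]
    ring
  have hDfin : ∀ k, ∫⁻ x, D k x ∂(expNegMeasure u) ≠ ∞ := fun k =>
    ((hDle k).trans_lt ENNReal.ofReal_lt_top).ne
  have hDint : ∀ k, Integrable (fun x => (D k x).toReal) (expNegMeasure u) := fun k =>
    integrable_toReal_of_lintegral_ne_top (hDm k).aemeasurable (hDfin k)
  have hne : ∀ᵐ x ∂(expNegMeasure u), x ∈ effDom u :=
    (ae_expNegMeasure_iff hulsc).2 (Eventually.of_forall fun _ => id)
  have hposD : ∀ᵐ x ∂(expNegMeasure u), ∀ k, D k x ≠ 0 := by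
    filter_upwards [hSae, hne] with x hx hxd k h0
    have h1 := hx.2
    rw [Finset.prod_eq_zero (Finset.mem_univ k) h0, mul_zero, ENNReal.ofReal_eq_zero] at h1
    exact h1.not_gt (expNegDensity_pos_iff.2 hxd)
  have hDreal : ∀ k, ∫ x, (D k x).toReal ∂(expNegMeasure u)
      ≤ ∫ x, S x k * realGradient u x k ∂(expNegMeasure u) := fun k => by
    have hpos : 0 < ∫ x, S x k * realGradient u x k ∂(expNegMeasure u) := by
      by_contra! hle
      have h0 := hDle k
      rw [ENNReal.ofReal_of_nonpos hle, nonpos_iff_eq_zero, lintegral_eq_zero_iff (hDm k)] at h0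
      have hF : ∀ᵐ x ∂(expNegMeasure u), False := by
        filter_upwards [h0, hposD] with x hx hx' using hx' k hx
      simp at hF
      exact NeZero.ne (expNegMeasure u) hF
    rw [integral_toReal (hDm k).aemeasurable (by filter_upwards [hSae] with x hx using hx.1 k)]
    exact ENNReal.toReal_le_of_le_ofReal hpos.le (hDle k)
  have hlogd : Integrable (fun y => Real.log (g y))
      (volume.withDensity fun y => ENNReal.ofReal (g y)) := by
    rw [integrable_withDensity_iff_integrable_smul' hg.ennreal_ofReal
      (Eventually.of_forall fun x => ENNReal.ofReal_lt_top)]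
    simpa only [ENNReal.toReal_ofReal (hg0 _), smul_eq_mul] using hglog
  have hlogint : Integrable (fun x => Real.log (g (S x))) (expNegMeasure u) := by
    rw [← hSmap] at hlogd
    exact hlogd.comp_measurable hS
  have hlogeq : ∫ x, Real.log (g (S x)) ∂(expNegMeasure u) = ∫ x, g x * Real.log (g x) := by
    rw [← integral_map (f := fun y => Real.log (g y)) hS.aemeasurable
      hg.log.aestronglyMeasurable, hSmap,
      integral_withDensity_eq_integral_toReal_smul hg.ennreal_ofReal
        (Eventually.of_forall fun x => ENNReal.ofReal_lt_top)]
    simp only [ENNReal.toReal_ofReal (hg0 _), smul_eq_mul]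
  have hpt : ∀ᵐ x ∂(expNegMeasure u),
      -(u x).toReal ≤ Real.log (g (S x)) + ∑ k, ((D k x).toReal - 1) := by
    filter_upwards [hSae, hposD, hne] with x hx hxD hxd
    have hfx : Real.exp (-(u x).toReal) = g (S x) * ∏ k, (D k x).toReal := by
      have := congrArg ENNReal.toReal hx.2
      rwa [ENNReal.toReal_mul, ENNReal.toReal_prod, ENNReal.toReal_ofReal (hg0 _),
        ENNReal.toReal_ofReal (expNegDensity_nonneg x), expNegDensity_of_mem hxd] at this
    have hDp : ∀ k, 0 < (D k x).toReal := fun k => ENNReal.toReal_pos (hxD k) (hx.1 k).ne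
    have hgp : g (S x) ≠ 0 := fun h => by
      rw [h, zero_mul] at hfx
      exact (Real.exp_pos _).ne' hfx
    have hlog := congrArg Real.log hfx
    rw [Real.log_exp, Real.log_mul hgp (Finset.prod_pos fun k _ => hDp k).ne',
      Real.log_prod fun k _ => (hDp k).ne'] at hlog
    rw [hlog]
    gcongr with k
    exact Real.log_le_sub_one_of_pos (hDp k)
  have hsub : ∀ k, Integrable (fun x => (D k x).toReal - 1) (expNegMeasure u) := fun k =>
    (hDint k).sub (integrable_const 1)
  have hsum : Integrable (fun x => ∑ k, ((D k x).toReal - 1)) (expNegMeasure u) :=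
    integrable_finsetSum Finset.univ fun k _ => hsub k
  have hmono := integral_mono_ae (integrable_toReal_expNegMeasure hubot huconv hulsc hnorm).fun_neg
    (hlogint.fun_add hsum) hpt
  rw [integral_neg, integral_add hlogint hsum, integral_finsetSum _ fun k _ => hsub k, hlogeq] at hmono
  have hk : ∀ k, ∫ x, ((D k x).toReal - 1) ∂(expNegMeasure u)
      ≤ (∫ x, S x k * realGradient u x k ∂(expNegMeasure u)) - 1 := fun k => by
    rw [integral_sub (hDint k) (integrable_const 1)]
    simpa using hDreal k
  have hle := Finset.sum_le_sum fun k (_ : k ∈ Finset.univ) => hk k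
  rw [Finset.sum_sub_distrib, ← integral_finsetSum _ fun k _ => hSgk k] at hle
  simp only [← hinner, Finset.sum_const, Finset.card_univ, Fintype.card_fin, nsmul_eq_mul,
    mul_one] at hle
  linarith

end KnotheMap

section PartialCoupling

variable {d : ℕ} {ρ μ : Measure (Ed d)}

theorem integrable_inner_prod [SFinite μ] {ν : Measure (Ed d)} [SFinite ν] (hν1 : FirstMoment ν)
    (hμ1 : FirstMoment μ) : Integrable (fun p : Ed d × Ed d => (⟪p.1, p.2⟫ : ℝ)) (ν.prod μ) := by
  refine (Integrable.mul_prod hν1 hμ1).mono' (by fun_prop) (Eventually.of_forall fun p => ?_)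
  exact norm_inner_le_norm p.1 p.2

theorem integral_inner_prod_eq_zero [SFinite μ] {ν : Measure (Ed d)} [SFinite ν] (hν1 : FirstMoment ν)
    (hμ1 : FirstMoment μ) (hμc : Centered μ) :
    ∫ p : Ed d × Ed d, (⟪p.1, p.2⟫ : ℝ) ∂(ν.prod μ) = 0 := by
  have hi : Integrable (fun y : Ed d => y) μ := (integrable_norm_iff (by fun_prop)).1 hμ1
  rw [integral_prod _ (integrable_inner_prod hν1 hμ1)]
  refine integral_eq_zero_of_ae (Eventually.of_forall fun x => ?_)
  have := integral_inner (𝕜 := ℝ) hi x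
  rw [show (∫ y, y ∂μ) = 0 from hμc, inner_zero_right] at this
  exact this

/-- A partial coupling, completed by a product measure, bounds the maximal correlation below. -/
theorem mul_integral_inner_le_maxCorr [IsProbabilityMeasure ρ] [IsProbabilityMeasure μ] (hρ1 : FirstMoment ρ) (hμ1 : FirstMoment μ)
    (hμc : Centered μ) {Ω : Type*} [MeasurableSpace Ω] {P : Measure Ω} [IsProbabilityMeasure P]
    {X Y : Ω → Ed d} (hX : Measurable X) (hY : Measurable Y) (hYμ : P.map Y = μ)
    {A : Set (Ed d)} (hA : MeasurableSet A) {c : ℝ} (hc : 0 ≤ c)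
    (hXρ : ENNReal.ofReal c • P.map X = ρ.restrict A)
    (hXY : Integrable (fun ω => (⟪X ω, Y ω⟫ : ℝ)) P) :
    ((c * ∫ ω, ⟪X ω, Y ω⟫ ∂P : ℝ) : EReal) ≤ maxCorr ρ μ := by
  have hXYm : Measurable fun ω => (X ω, Y ω) := hX.prodMk hY
  set γ : Measure (Ed d × Ed d) :=
    ENNReal.ofReal c • P.map (fun ω => (X ω, Y ω)) + (ρ.restrict Aᶜ).prod μ with hγ
  have hcA : ENNReal.ofReal c = ρ A := by
    have := congrArg (fun m : Measure (Ed d) => m Set.univ) hXρ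
    simpa [Measure.map_apply hX MeasurableSet.univ] using this
  have hfst : γ.fst = ρ := by
    have h1 : (P.map fun ω => (X ω, Y ω)).fst = P.map X := Measure.fst_map_prodMk hY
    rw [hγ, Measure.fst, Measure.map_add _ _ measurable_fst, Measure.map_smul]
    change ENNReal.ofReal c • (P.map fun ω => (X ω, Y ω)).fst + ((ρ.restrict Aᶜ).prod μ).fst = ρ
    rw [h1, hXρ, Measure.fst_prod, Measure.restrict_add_restrict_compl hA]
  have hsnd : γ.snd = μ := by
    have h1 : (P.map fun ω => (X ω, Y ω)).snd = P.map Y := Measure.snd_map_prodMk hX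
    rw [hγ, Measure.snd, Measure.map_add _ _ measurable_snd, Measure.map_smul]
    change ENNReal.ofReal c • (P.map fun ω => (X ω, Y ω)).snd + ((ρ.restrict Aᶜ).prod μ).snd = μ
    rw [h1, hYμ, hcA, Measure.snd, Measure.map_snd_prod, Measure.restrict_apply MeasurableSet.univ,
      Set.univ_inter, ← add_smul, measure_add_measure_compl hA, measure_univ, one_smul]
  have hprob : IsProbabilityMeasure γ := by
    have : γ.fst Set.univ = 1 := by rw [hfst]; exact measure_univ
    rw [Measure.fst_univ] at this
    exact ⟨this⟩
  have hA1 : FirstMoment (ρ.restrict Aᶜ) := Integrable.restrict hρ1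
  have hi1 : Integrable (fun p : Ed d × Ed d => (⟪p.1, p.2⟫ : ℝ)) (P.map fun ω => (X ω, Y ω)) :=
    (integrable_map_measure (by fun_prop) hXYm.aemeasurable).2 hXY
  have hi2 := hi1.smul_measure (c := ENNReal.ofReal c) ENNReal.ofReal_ne_top
  have hi3 := integrable_inner_prod hA1 hμ1
  have hval : pairInt γ = ((c * ∫ ω, ⟪X ω, Y ω⟫ ∂P : ℝ) : EReal) := by
    change eintegral γ (fun p => (⟪p.1, p.2⟫ : ℝ)) = _
    rw [eintegral_eq_integral (hi2.add_measure hi3), integral_add_measure hi2 hi3,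
      integral_smul_measure, integral_inner_prod_eq_zero hA1 hμ1 hμc, ENNReal.toReal_ofReal hc,
      integral_map hXYm.aemeasurable (by fun_prop), add_zero, smul_eq_mul]
  rw [← hval]
  exact le_iSup₂_of_le γ ⟨hprob, hfst, hsnd⟩ le_rfl

theorem maxCorr_nonneg [IsProbabilityMeasure ρ] [IsProbabilityMeasure μ] (hρ1 : FirstMoment ρ) (hμ1 : FirstMoment μ) (hμc : Centered μ) :
    0 ≤ maxCorr ρ μ := by
  have := mul_integral_inner_le_maxCorr hρ1 hμ1 hμc (P := μ) (X := fun _ => 0) (Y := id)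
    measurable_const measurable_id Measure.map_id MeasurableSet.empty le_rfl (by simp) (by simp)
  simpa using this

end PartialCoupling

section LowerBound

variable {d : ℕ} {u : Ed d → EReal} {ρ μ : Measure (Ed d)} [IsProbabilityMeasure ρ]
  [IsProbabilityMeasure μ]

theorem neg_mul_log_le {t : ℝ} (ht : 0 ≤ t) (a : ℝ) :
    -(t * Real.log t) ≤ t * a + Real.exp (-a) := by
  rcases ht.eq_or_lt with rfl | ht
  · simp [Real.exp_nonneg]
  have h := Real.add_one_le_exp (-a - Real.log t)
  rw [Real.exp_sub, Real.exp_log ht, le_div_iff₀ ht] at h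
  nlinarith

theorem lintegral_neg_mul_log_ne_top {g : Ed d → ℝ} (hg0 : ∀ x, 0 ≤ g x)
    (hg1 : Integrable fun x => g x * ‖x‖) :
    ∫⁻ x, ENNReal.ofReal (-(g x * Real.log (g x))) ≠ ∞ := by
  have hexp : Integrable fun x : Ed d => Real.exp (-‖x‖) := by
    simpa using integrable_exp_neg_mul_norm (d := d) one_pos
  refine ((lintegral_mono fun x => ENNReal.ofReal_le_ofReal
    (neg_mul_log_le (hg0 x) ‖x‖)).trans_lt (hg1.add hexp).lintegral_lt_top).ne

/-- The lower bound for probability densities with integrable `g log g`. -/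
theorem sub_le_maxCorr_of_integrable_mul_log (hubot : ∀ x, u x ≠ ⊥)
    (huconv : EConvexOn u) (hulsc : LowerSemicontinuous u) (hess : EssentiallyContinuous u)
    (hnorm : ∫ x, expNegDensity u x = 1) (hμ1 : FirstMoment μ) (hμc : Centered μ)
    (hpush : (expNegMeasure u).map (realGradient u) = μ) (hρ1 : FirstMoment ρ)
    {g : Ed d → ℝ} (hg : Measurable g) (hg0 : ∀ x, 0 ≤ g x)
    (hρg : ρ = volume.withDensity fun x => ENNReal.ofReal (g x))
    (hglog : Integrable fun x => g x * Real.log (g x)) :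
    ((d - (∫ x, (u x).toReal ∂(expNegMeasure u)) - ∫ x, g x * Real.log (g x) : ℝ) : EReal)
      ≤ maxCorr ρ μ := by
  have := isProbabilityMeasure_expNegMeasure hnorm
  set L : ℝ := d - ∫ x, (u x).toReal ∂(expNegMeasure u)
  set A : ℕ → Set (Ed d) := fun n => {x | ‖x‖ ≤ n ∧ g x ≤ n} with hAdef
  have hA : ∀ n, MeasurableSet (A n) := fun n =>
    (measurableSet_le measurable_norm measurable_const).inter (measurableSet_le hg measurable_const)
  have hAmono : Monotone A := fun m n hmn x hx =>
    ⟨hx.1.trans (Nat.cast_le.2 hmn), hx.2.trans (Nat.cast_le.2 hmn)⟩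
  have hAuniv : ⋃ n, A n = Set.univ := by
    refine Set.eq_univ_of_forall fun x => Set.mem_iUnion.2 ?_
    obtain ⟨n, hn⟩ := exists_nat_ge (max ‖x‖ (g x))
    exact ⟨n, (le_max_left _ _).trans hn, (le_max_right _ _).trans hn⟩
  set c : ℕ → ℝ := fun n => ρ.real (A n) with hcdef
  have hc : Tendsto c atTop (𝓝 1) := by
    have := tendsto_measure_iUnion_atTop (μ := ρ) hAmono
    rw [hAuniv, measure_univ] at this
    exact (ENNReal.tendsto_toReal ENNReal.one_ne_top).comp this
  have hI : Tendsto (fun n => ∫ x in A n, g x * Real.log (g x)) atTop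
      (𝓝 (∫ x, g x * Real.log (g x))) := by
    have := tendsto_setIntegral_of_monotone (μ := volume) hA hAmono hglog.integrableOn
    rwa [hAuniv, setIntegral_univ] at this
  have hlim : Tendsto (fun n => c n * L - ((∫ x in A n, g x * Real.log (g x))
      - c n * Real.log (c n))) atTop (𝓝 (L - ∫ x, g x * Real.log (g x))) := by
    have h1 : Tendsto (fun n => c n * Real.log (c n)) atTop (𝓝 (1 * Real.log 1)) :=
      (Real.continuous_mul_log.tendsto 1).comp hc
    have := (hc.mul_const L).sub (hI.sub h1)
    simpa using this
  refine le_of_tendsto ((continuous_coe_real_ereal.tendsto _).comp hlim) ?_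
  filter_upwards [hc.eventually (lt_mem_nhds one_pos)] with n hn
  have hρA : ρ.restrict (A n)
      = volume.withDensity ((A n).indicator fun x => ENNReal.ofReal (g x)) := by
    rw [hρg, restrict_withDensity (hA n), withDensity_indicator (hA n)]
  have hcn : ENNReal.ofReal (c n) = ρ (A n) := ENNReal.ofReal_toReal (measure_ne_top _ _)
  set gn : Ed d → ℝ := (A n).indicator fun x => g x / c n with hgn
  have hgnm : Measurable gn := (hg.div_const _).indicator (hA n)
  have hgn0 : ∀ x, 0 ≤ gn x := fun x => Set.indicator_nonneg (fun x _ => div_nonneg (hg0 x) hn.le) x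
  have hdens : ENNReal.ofReal (c n) • volume.withDensity (fun x => ENNReal.ofReal (gn x))
      = ρ.restrict (A n) := by
    rw [hρA, ← withDensity_smul _ hgnm.ennreal_ofReal]
    congr 1
    ext x
    by_cases hx : x ∈ A n
    · simp only [hgn, Pi.smul_apply, Set.indicator_of_mem hx, smul_eq_mul]
      rw [← ENNReal.ofReal_mul hn.le, mul_div_cancel₀ _ hn.ne']
    · simp [hgn, Set.indicator_of_notMem hx]
  have hgn1 : ∫⁻ x, ENNReal.ofReal (gn x) = 1 := by
    have := congrArg (fun m : Measure (Ed d) => m Set.univ) hdens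
    simp only [Measure.smul_apply, withDensity_apply _ MeasurableSet.univ, Measure.restrict_univ,
      Measure.restrict_apply MeasurableSet.univ, Set.univ_inter, smul_eq_mul, ← hcn] at this
    have h0 : ENNReal.ofReal (c n) ≠ 0 := by simpa using hn
    rwa [ENNReal.mul_eq_left h0 ENNReal.ofReal_ne_top] at this
  have hgnM : ∀ x, gn x ≤ n / c n := fun x => by
    by_cases hx : x ∈ A n
    · rw [hgn, Set.indicator_of_mem hx]
      have := hx.2
      gcongr
    · rw [hgn, Set.indicator_of_notMem hx]
      positivity
  obtain ⟨S, hS, hSint, hSmap, -, hSle⟩ := integral_mul_log_add_integral_inner_ge_of_bounded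
    hubot huconv hulsc hess hnorm (integrable_realGradient hμ1 hpush) hgnm hgn0
    (Nat.cast_nonneg n) hgnM (fun x hx => (Set.mem_of_indicator_ne_zero hx).1) hgn1
  have hgA : ∫ x in A n, g x = c n := by
    rw [integral_eq_lintegral_of_nonneg_ae (Eventually.of_forall hg0) hg.aestronglyMeasurable,
      ← withDensity_apply _ (hA n), ← hρg]
    rfl
  have hgi : IntegrableOn g (A n) := by
    by_contra h
    rw [integral_undef h] at hgA
    exact hn.ne hgA
  have hent : c n * ∫ x, gn x * Real.log (gn x)
      = (∫ x in A n, g x * Real.log (g x)) - c n * Real.log (c n) := by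
    have hpt : ∀ x, c n * (gn x * Real.log (gn x))
        = (A n).indicator (fun x => g x * Real.log (g x) - g x * Real.log (c n)) x := fun x => by
      by_cases hx : x ∈ A n
      · simp only [hgn, Set.indicator_of_mem hx]
        rcases (hg0 x).eq_or_lt with h0 | h0
        · simp [← h0]
        · rw [Real.log_div h0.ne' hn.ne']
          field_simp
      · simp [hgn, Set.indicator_of_notMem hx]
    rw [← integral_const_mul]
    simp only [hpt]
    rw [integral_indicator (hA n), integral_sub hglog.integrableOn (hgi.mul_const _),
      integral_mul_const, hgA]
  have hmain := mul_integral_inner_le_maxCorr hρ1 hμ1 hμc hS measurable_realGradient hpush (hA n)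
    hn.le (by rw [hSmap, hdens]) hSint
  refine le_trans ?_ hmain
  rw [Function.comp_apply, EReal.coe_le_coe_iff, ← hent]
  have := mul_le_mul_of_nonneg_left hSle hn.le
  rw [mul_add] at this
  linarith

theorem le_entropy_add_maxCorr (hubot : ∀ x, u x ≠ ⊥)
    (huconv : EConvexOn u) (hulsc : LowerSemicontinuous u) (hess : EssentiallyContinuous u)
    (hnorm : ∫ x, expNegDensity u x = 1) (hμ1 : FirstMoment μ) (hμc : Centered μ)
    (hpush : (expNegMeasure u).map (realGradient u) = μ) (hρ1 : FirstMoment ρ) :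
    ((d - ∫ x, (u x).toReal ∂(expNegMeasure u) : ℝ) : EReal) ≤ entropy ρ + maxCorr ρ μ := by
  have hT := maxCorr_nonneg hρ1 hμ1 hμc
  have htop : entropy ρ = ⊤ → ((d - ∫ x, (u x).toReal ∂(expNegMeasure u) : ℝ) : EReal)
      ≤ entropy ρ + maxCorr ρ μ := fun h => by
    rw [h, EReal.top_add_of_ne_bot (ne_bot_of_le_ne_bot EReal.zero_ne_bot hT)]
    exact le_top
  by_cases hac : ρ ≪ (volume : Measure (Ed d))
  swap
  · exact htop (if_neg hac)
  set g : Ed d → ℝ := fun x => (ρ.rnDeriv volume x).toReal with hgdef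
  have hg : Measurable g := (Measure.measurable_rnDeriv ρ volume).ennreal_toReal
  have hg0 : ∀ x, 0 ≤ g x := fun x => ENNReal.toReal_nonneg
  have hρg : ρ = volume.withDensity fun x => ENNReal.ofReal (g x) := by
    conv_lhs => rw [← Measure.withDensity_rnDeriv_eq ρ volume hac]
    refine withDensity_congr_ae ?_
    filter_upwards [Measure.rnDeriv_lt_top ρ volume] with x hx
    rw [hgdef, ENNReal.ofReal_toReal hx.ne]
  have hg1 : Integrable fun x => g x * ‖x‖ := by
    have h : Integrable (fun x => ‖x‖) ρ := hρ1
    rw [hρg, integrable_withDensity_iff_integrable_smul' hg.ennreal_ofReal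
      (Eventually.of_forall fun x => ENNReal.ofReal_lt_top)] at h
    simpa only [ENNReal.toReal_ofReal (hg0 _), smul_eq_mul] using h
  have hneg := lintegral_neg_mul_log_ne_top hg0 hg1
  have hent := entropy_of_ac hac
  by_cases hpos : ∫⁻ x, ENNReal.ofReal (g x * Real.log (g x)) = ∞
  · refine htop ?_
    rw [hent, eintegral, hpos, ← EReal.coe_ennreal_toReal hneg]
    exact EReal.top_sub_coe _
  have hgm : Measurable fun x => g x * Real.log (g x) := hg.mul hg.log
  have hglog : Integrable fun x => g x * Real.log (g x) := by
    have h1 := integrable_toReal_of_lintegral_ne_top hgm.ennreal_ofReal.aemeasurable hpos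
    have h2 := integrable_toReal_of_lintegral_ne_top hgm.neg.ennreal_ofReal.aemeasurable hneg
    refine (h1.sub h2).congr (Eventually.of_forall fun x => ?_)
    simp only [Pi.sub_apply, ENNReal.toReal_ofReal', Pi.neg_apply]
    exact max_zero_sub_eq_self _
  rw [eintegral_eq_integral hglog] at hent
  have hle := sub_le_maxCorr_of_integrable_mul_log hubot huconv hulsc hess hnorm hμ1 hμc hpush hρ1
    hg hg0 hρg hglog
  rw [hent]
  refine le_trans (le_of_eq ?_) (add_le_add_right hle _)
  rw [← EReal.coe_add]
  congr 1
  ring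

end LowerBound

/-- sufficiency — if `u` is convex, l.s.c., proper, essentially continuous,
`e^{-u}` integrates to `1` and `(∇u)_#(e^{-u} dx) = μ`, then `e^{-u} dx` minimizes
`E(·) + T(·,μ)` over `P_1`. -/
theorem moment_map_is_minimizer {d : ℕ} (hd : 1 ≤ d)
    (μ : Measure (Ed d)) [IsProbabilityMeasure μ] (hμ1 : FirstMoment μ) (hμc : Centered μ)
    (u : Ed d → EReal) (hubot : ∀ x, u x ≠ ⊥) (huconv : EConvexOn u)
    (hulsc : LowerSemicontinuous u) (huproper : ∃ x, u x ≠ ⊤)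
    (hess : EssentiallyContinuous u)
    (hnorm : (∫ x : Ed d, expNegE (u x)) = 1)
    (ρ' : Measure (Ed d))
    (hρ' : ρ' = volume.withDensity (fun x => ENNReal.ofReal (expNegE (u x))))
    (hpush : ρ'.map (fun x => gradient (fun y => (u y).toReal) x) = μ) :
    FirstMoment ρ' ∧
      ∀ ρ : Measure (Ed d), IsProbabilityMeasure ρ → FirstMoment ρ →
        entropy ρ' + maxCorr ρ' μ ≤ entropy ρ + maxCorr ρ μ := by
  have hprob : IsProbabilityMeasure (expNegMeasure u) := isProbabilityMeasure_expNegMeasure hnorm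
  have hρ'' : ρ' = expNegMeasure u := hρ'
  subst hρ''
  refine ⟨firstMoment_expNegMeasure hubot huconv hulsc hnorm, fun ρ hρ hρ1 => ?_⟩
  refine le_trans ?_
    (le_entropy_add_maxCorr hubot huconv hulsc hess hnorm hμ1 hμc hpush hρ1)
  rw [entropy_expNegMeasure hubot huconv hulsc hnorm]
  refine (add_le_add_right
    (maxCorr_expNegMeasure_le hubot huconv hulsc hnorm hμ1 hμc hpush) _).trans_eq ?_
  rw [← EReal.coe_add, neg_add_eq_sub]
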